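/- arXiv:2411.15578 — 2 statements merged into one kernel-verified Lean document; each statement's English description precedes it below -/
import Mathlib

section
/- Let F be a function holomorphic in a neighborhood of the set (𝕋+1) ∪ {0} with F(0) = 0, where 𝕋+1 = {z ∈ ℂ : |z−1| = 1} is the spectrum of the continuous Cesàro operator 𝒞 on L²(ℝ). Then F(𝒞) (defined by the holomorphic Riesz–Dunford functional calculus) equals the Hausdorff operator ℋ_K for a unique measurable function K, and this K satisfies: (a) K(u) = 0 for a.e. u < 0; (b) K(u)·u^{−1/2} ∈ L¹(0,∞); (c) the Mellin transform satisfies (ℳK)(z) = F(1/z) for all z on the line Re z = 1/2. -/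
open MeasureTheory Complex Filter

noncomputable section

/-- `L²(ℝ)` with complex values. -/
abbrev L2 : Type := MeasureTheory.Lp ℂ 2 (MeasureTheory.volume : MeasureTheory.Measure ℝ)

/-- `C` is the continuous Cesàro operator on `L²(ℝ)`:
`(C f)(x) = ∫₀¹ f(ux) du`. -/
def IsCesaroOp (C : L2 →L[ℂ] L2) : Prop :=
  ∀ f : L2, ∀ᵐ x : ℝ ∂MeasureTheory.volume, C f x = ∫ u in Set.Ioo (0:ℝ) 1, f (u * x)

/-- `T` is the Hausdorff operator with kernel `K`:
`(T f)(x) = ∫_ℝ K(u) f(ux) du`. -/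
def IsHausdorffOp (K : ℝ → ℂ) (T : L2 →L[ℂ] L2) : Prop :=
  ∀ f : L2, ∀ᵐ x : ℝ ∂MeasureTheory.volume, T f x = ∫ u : ℝ, K u * f (u * x)

/-- The kernel condition `K(u)|u|^{-1/2} ∈ L¹(ℝ)`. -/
def HausdorffKernelCond (K : ℝ → ℂ) : Prop :=
  MeasureTheory.Integrable (fun u : ℝ => ‖K u‖ * |u| ^ (-(1/2) : ℝ))

/-- Lebesgue measure on the positive half-line. -/
abbrev muP : Measure ℝ := volume.restrict (Set.Ioi 0)

lemma lintegral_scale (g : ℝ → ENNReal) (hg : Measurable g) (u : ℝ) (hu : 0 < u) :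
    ENNReal.ofReal u * ∫⁻ x, g (u * x) = ∫⁻ x, g x := by
  have h := Real.smul_map_volume_mul_left hu.ne'
  rw [abs_of_pos hu] at h
  conv_rhs => rw [← h]
  rw [lintegral_smul_measure, lintegral_map hg (measurable_const_mul u), smul_eq_mul]

lemma lintegral_sq_le {α : Type*} [MeasurableSpace α] (ν : Measure α) (φ : α → ENNReal)
    (hφ : AEMeasurable φ ν) : (∫⁻ u, φ u ∂ν) ^ 2 ≤ ν Set.univ * ∫⁻ u, φ u ^ 2 ∂ν := by
  have h := ENNReal.lintegral_mul_le_Lp_mul_Lq ν (p := 2) (q := 2) (by constructor <;> norm_num)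
    hφ (aemeasurable_const (b := (1:ENNReal)))
  simp only [Pi.mul_apply, mul_one, ENNReal.one_rpow, lintegral_const, one_mul] at h
  have h2 := pow_le_pow_left' h 2
  rw [mul_pow, ← ENNReal.rpow_natCast, ← ENNReal.rpow_natCast, ← ENNReal.rpow_natCast,
    ← ENNReal.rpow_mul, ← ENNReal.rpow_mul] at h2
  norm_num at h2
  rw [mul_comm]
  exact h2

lemma kern_bound (k g : ℝ → ENNReal) (hk : Measurable k) (hg : Measurable g) :
    ∫⁻ x, (∫⁻ u in Set.Ioi 0, k u * (ENNReal.ofReal (u ^ (1/2:ℝ)) * g (u * x))) ^ 2 ≤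
      (∫⁻ u in Set.Ioi 0, k u) ^ 2 * ∫⁻ x, g x ^ 2 := by
  set ν := muP.withDensity k with hν
  have h1 : ∀ x, (∫⁻ u in Set.Ioi 0, k u * (ENNReal.ofReal (u ^ (1/2:ℝ)) * g (u * x))) =
      ∫⁻ u, (ENNReal.ofReal (u ^ (1/2:ℝ)) * g (u * x)) ∂ν := by
    intro x
    rw [hν, lintegral_withDensity_eq_lintegral_mul _ hk (by fun_prop)]
    rfl
  have hu : ν Set.univ = ∫⁻ u in Set.Ioi 0, k u := by
    rw [hν, withDensity_apply _ MeasurableSet.univ, Measure.restrict_univ]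
  simp_rw [h1]
  calc _ ≤ ∫⁻ x, ν Set.univ * ∫⁻ u, (ENNReal.ofReal (u ^ (1/2:ℝ)) * g (u * x)) ^ 2 ∂ν :=
        lintegral_mono fun x => lintegral_sq_le ν _ (by fun_prop)
    _ = ν Set.univ * ∫⁻ x, (∫⁻ u, (ENNReal.ofReal (u ^ (1/2:ℝ)) * g (u * x)) ^ 2 ∂ν) := by
        rw [lintegral_const_mul]
        exact Measurable.lintegral_prod_right' (f := fun p : ℝ × ℝ =>
          (ENNReal.ofReal (p.2 ^ (1/2:ℝ)) * g (p.2 * p.1)) ^ 2) (by fun_prop)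
    _ = ν Set.univ * ∫⁻ u, (∫⁻ x, (ENNReal.ofReal (u ^ (1/2:ℝ)) * g (u * x)) ^ 2) ∂ν := by
        rw [lintegral_lintegral_swap]
        exact Measurable.aemeasurable (f := fun p : ℝ × ℝ => (ENNReal.ofReal (p.2 ^ (1/2:ℝ)) * g (p.2 * p.1)) ^ 2) (by fun_prop)
    _ = ν Set.univ * ∫⁻ u, (∫⁻ x, g x ^ 2) ∂ν := by
        congr 1
        apply lintegral_congr_ae
        have hac : ν ≪ muP := withDensity_absolutelyContinuous _ _
        filter_upwards [hac.ae_le (ae_restrict_mem measurableSet_Ioi)] with u hu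
        have hu : 0 < u := hu
        rw [← lintegral_scale (fun x => g x ^ 2) (by fun_prop) u hu, ← lintegral_const_mul _ (by fun_prop)]
        congr 1; ext x
        rw [mul_pow, ← ENNReal.ofReal_pow (by positivity), ← Real.rpow_natCast, ← Real.rpow_mul hu.le]
        norm_num
    _ = _ := by
        rw [lintegral_const, hu]; ring

lemma eLpNorm_two_sq (φ : ℝ → ℂ) : eLpNorm φ 2 volume ^ 2 = ∫⁻ x, ‖φ x‖ₑ ^ 2 := by
  have h := eLpNorm_nnreal_pow_eq_lintegral (f := φ) (μ := volume) (p := 2) (by norm_num)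
  have e2 : ((2 : NNReal) : ℝ) = ((2:ℕ):ℝ) := by norm_num
  simp only [e2, ENNReal.rpow_natCast] at h
  exact h

/-- Pointwise kernel operator. -/
def tfun (h f : ℝ → ℂ) (x : ℝ) : ℂ :=
  ∫ u in Set.Ioi 0, h u * (((u ^ (1/2:ℝ) : ℝ) : ℂ) * f (u * x))

lemma enorm_ker (h f : ℝ → ℂ) (x u : ℝ) (hu : 0 < u) :
    ‖h u * (((u ^ (1/2:ℝ) : ℝ) : ℂ) * f (u * x))‖ₑ =
      ‖h u‖ₑ * (ENNReal.ofReal (u ^ (1/2:ℝ)) * ‖f (u * x)‖ₑ) := by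
  rw [enorm_mul, enorm_mul]
  congr 2
  rw [← ofReal_norm, Complex.norm_real, Real.norm_of_nonneg (by positivity)]

lemma lintegral_enorm_ker (h f : ℝ → ℂ) (x : ℝ) :
    ∫⁻ u in Set.Ioi 0, ‖h u * (((u ^ (1/2:ℝ) : ℝ) : ℂ) * f (u * x))‖ₑ =
      ∫⁻ u in Set.Ioi 0, ‖h u‖ₑ * (ENNReal.ofReal (u ^ (1/2:ℝ)) * ‖f (u * x)‖ₑ) :=
  setLIntegral_congr_fun measurableSet_Ioi fun u hu => enorm_ker h f x u hu

lemma tfun_meas (h f : ℝ → ℂ) (hh : Measurable h) (hf : Measurable f) :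
    StronglyMeasurable (tfun h f) := by
  apply StronglyMeasurable.integral_prod_right' (f := fun p : ℝ × ℝ =>
    h p.2 * (((p.2 ^ (1/2:ℝ) : ℝ) : ℂ) * f (p.2 * p.1)))
  exact Measurable.stronglyMeasurable (by fun_prop)

lemma tfun_bound (h f : ℝ → ℂ) (hh : Measurable h) (hf : Measurable f) :
    eLpNorm (tfun h f) 2 volume ≤ eLpNorm h 1 muP * eLpNorm f 2 volume := by
  rw [← ENNReal.pow_le_pow_left_iff (n := 2) (by norm_num), mul_pow, eLpNorm_two_sq, eLpNorm_two_sq,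
    eLpNorm_one_eq_lintegral_enorm]
  refine le_trans (lintegral_mono fun x => ?_) (kern_bound (fun u => ‖h u‖ₑ) (fun x => ‖f x‖ₑ)
    hh.enorm hf.enorm)
  refine pow_le_pow_left' ?_ 2
  rw [← lintegral_enorm_ker]
  exact enorm_integral_le_lintegral_enorm _

lemma kern_fin (k g : ℝ → ENNReal) (hk : Measurable k) (hg : Measurable g)
    (hk' : ∫⁻ u in Set.Ioi 0, k u ≠ ⊤) (hg' : ∫⁻ x, g x ^ 2 ≠ ⊤) :
    ∀ᵐ x, (∫⁻ u in Set.Ioi 0, k u * (ENNReal.ofReal (u ^ (1/2:ℝ)) * g (u * x))) < ⊤ := by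
  have h := kern_bound k g hk hg
  have hm : Measurable fun x : ℝ => (∫⁻ u in Set.Ioi 0, k u * (ENNReal.ofReal (u ^ (1/2:ℝ)) * g (u * x))) ^ 2 := by
    refine Measurable.pow_const ?_ 2
    exact Measurable.lintegral_prod_right' (f := fun p : ℝ × ℝ =>
          k p.2 * (ENNReal.ofReal (p.2 ^ (1/2:ℝ)) * g (p.2 * p.1))) (by fun_prop)
  have := ae_lt_top hm (ne_top_of_le_ne_top (ENNReal.mul_ne_top (ENNReal.pow_ne_top hk') hg') h)
  filter_upwards [this] with x hx
  by_contra hc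
  rw [not_lt, top_le_iff] at hc
  rw [hc] at hx
  simp at hx

lemma tfun_integrable (h f : ℝ → ℂ) (hh : Measurable h) (hf : Measurable f)
    (hh' : Integrable h muP) (hf' : MemLp f 2 volume) :
    ∀ᵐ x, Integrable (fun u => h u * (((u ^ (1/2:ℝ) : ℝ) : ℂ) * f (u * x))) muP := by
  have := kern_fin (fun u => ‖h u‖ₑ) (fun x => ‖f x‖ₑ) hh.enorm hf.enorm hh'.2.ne (by
    rw [← eLpNorm_two_sq]; exact ENNReal.pow_ne_top hf'.2.ne)
  filter_upwards [this] with x hx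
  refine ⟨Measurable.aestronglyMeasurable (by fun_prop), ?_⟩
  rw [hasFiniteIntegral_iff_enorm, lintegral_enorm_ker]
  exact hx

lemma tfun_memLp (h f : ℝ → ℂ) (hh : Measurable h) (hf : Measurable f)
    (hh' : Integrable h muP) (hf' : MemLp f 2 volume) : MemLp (tfun h f) 2 volume := by
  refine ⟨(tfun_meas h f hh hf).aestronglyMeasurable, (tfun_bound h f hh hf).trans_lt ?_⟩
  exact ENNReal.mul_lt_top (memLp_one_iff_integrable.2 hh').2 hf'.2

lemma ae_scale {P : ℝ → Prop} (h : ∀ᵐ y, P y) (x : ℝ) (hx : x ≠ 0) : ∀ᵐ u, P (u * x) := by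
  have hq : Measure.QuasiMeasurePreserving (fun u : ℝ => u * x) volume volume := by
    refine ⟨measurable_mul_const x, ?_⟩
    rw [Real.map_volume_mul_right hx]
    exact Measure.smul_absolutelyContinuous
  exact hq.ae h

lemma ae_ne_zero : ∀ᵐ x : ℝ, x ≠ 0 := by
  simp [ae_iff]

lemma tfun_congr_right (h f g : ℝ → ℂ) (hfg : f =ᵐ[volume] g) (x : ℝ) (hx : x ≠ 0) :
    tfun h f x = tfun h g x := by
  apply integral_congr_ae
  filter_upwards [ae_restrict_of_ae (ae_scale hfg x hx)] with u hu
  rw [hu]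

lemma tfun_congr_left (h k f : ℝ → ℂ) (hhk : h =ᵐ[muP] k) (x : ℝ) :
    tfun h f x = tfun k f x := by
  apply integral_congr_ae
  filter_upwards [hhk] with u hu
  rw [hu]

abbrev L1P : Type := Lp ℂ 1 muP

lemma L1P.meas (h : L1P) : Measurable h := (Lp.stronglyMeasurable h).measurable
lemma L2.meas (h : L2) : Measurable h := (Lp.stronglyMeasurable h).measurable
lemma L1P.int (h : L1P) : Integrable h muP := L1.integrable_coeFn h

def topFun (h : L1P) (f : L2) : L2 :=
  (tfun_memLp h f h.meas f.meas h.int (Lp.memLp f)).toLp _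

lemma topFun_coe (h : L1P) (f : L2) : topFun h f =ᵐ[volume] tfun h f := MemLp.coeFn_toLp _

def topLin : L1P →ₗ[ℂ] L2 →ₗ[ℂ] L2 :=
  LinearMap.mk₂ ℂ topFun
    (by
      intro h k f
      apply Lp.ext
      filter_upwards [topFun_coe (h + k) f, topFun_coe h f, topFun_coe k f,
        Lp.coeFn_add (topFun h f) (topFun k f),
        tfun_integrable h f h.meas f.meas h.int (Lp.memLp f),
        tfun_integrable k f k.meas f.meas k.int (Lp.memLp f)] with x h1 h2 h3 h4 h5 h6
      rw [h1, h4, Pi.add_apply, h2, h3, tfun_congr_left _ _ _ (Lp.coeFn_add h k) x]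
      unfold tfun
      rw [← integral_add h5 h6]
      simp [add_mul])
    (by
      intro c h f
      apply Lp.ext
      filter_upwards [topFun_coe (c • h) f, topFun_coe h f,
        Lp.coeFn_smul c (topFun h f)] with x h1 h2 h4
      rw [h1, h4, Pi.smul_apply, h2, tfun_congr_left _ _ _ (Lp.coeFn_smul c h) x]
      unfold tfun
      rw [← integral_smul]
      simp [mul_assoc])
    (by
      intro h f g
      apply Lp.ext
      filter_upwards [topFun_coe h (f + g), topFun_coe h f, topFun_coe h g,
        Lp.coeFn_add (topFun h f) (topFun h g), ae_ne_zero,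
        tfun_integrable h f h.meas f.meas h.int (Lp.memLp f),
        tfun_integrable h g h.meas g.meas h.int (Lp.memLp g)] with x h1 h2 h3 h4 hx h5 h6
      rw [h1, h4, Pi.add_apply, h2, h3, tfun_congr_right _ _ _ (Lp.coeFn_add f g) x hx]
      unfold tfun
      rw [← integral_add h5 h6]
      simp [mul_add])
    (by
      intro c h f
      apply Lp.ext
      filter_upwards [topFun_coe h (c • f), topFun_coe h f,
        Lp.coeFn_smul c (topFun h f), ae_ne_zero] with x h1 h2 h4 hx
      rw [h1, h4, Pi.smul_apply, h2, tfun_congr_right _ _ _ (Lp.coeFn_smul c f) x hx]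
      unfold tfun
      rw [← integral_smul]
      congr 1; ext u
      simp only [Pi.smul_apply, smul_eq_mul]; ring)

lemma topFun_norm (h : L1P) (f : L2) : ‖topFun h f‖ ≤ 1 * ‖h‖ * ‖f‖ := by
  rw [one_mul, topFun, Lp.norm_toLp, Lp.norm_def, Lp.norm_def, ← ENNReal.toReal_mul]
  exact ENNReal.toReal_mono (ENNReal.mul_ne_top (Lp.eLpNorm_ne_top h) (Lp.eLpNorm_ne_top f))
    (tfun_bound h f h.meas f.meas)

/-- The operator attached to an integrable weight. -/
def TOp : L1P →L[ℂ] L2 →L[ℂ] L2 := LinearMap.mkContinuous₂ topLin 1 topFun_norm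

lemma TOp_coe (h : L1P) (f : L2) : TOp h f =ᵐ[volume] tfun h f := topFun_coe h f

lemma lintegral_scale_Ioi (g : ℝ → ENNReal) (hg : Measurable g) (u : ℝ) (hu : 0 < u) :
    ENNReal.ofReal u * ∫⁻ v in Set.Ioi 0, g (u * v) = ∫⁻ t in Set.Ioi 0, g t := by
  rw [← lintegral_indicator measurableSet_Ioi, ← lintegral_indicator measurableSet_Ioi,
    ← lintegral_scale _ (hg.indicator measurableSet_Ioi) u hu]
  congr 2; ext v
  by_cases hv : 0 < v
  · rw [Set.indicator_of_mem (by exact hv), Set.indicator_of_mem (by exact mul_pos hu hv)]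
  · rw [Set.indicator_of_notMem (by exact hv), Set.indicator_of_notMem]
    intro h
    exact hv (pos_of_mul_pos_right (Set.mem_Ioi.1 h) hu.le)

lemma tfun_comp (h k m f : ℝ → ℂ) (hh : Measurable h) (hk : Measurable k) (hf : Measurable f)
    (hh' : Integrable h muP) (hk' : Integrable k muP) (hf' : MemLp f 2 volume)
    (hconv : ∀ t, 0 < t → ∫ u in Set.Ioi 0, h u * k (t / u) * ((u⁻¹ : ℝ) : ℂ) = m t) :
    ∀ᵐ x, tfun h (tfun k f) x = tfun m f x := by
  have hgm : Measurable fun y : ℝ => ∫⁻ v in Set.Ioi 0, ‖k v‖ₑ * (ENNReal.ofReal (v ^ (1/2:ℝ)) * ‖f (v * y)‖ₑ) :=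
    Measurable.lintegral_prod_right' (f := fun p : ℝ × ℝ =>
          ‖k p.2‖ₑ * (ENNReal.ofReal (p.2 ^ (1/2:ℝ)) * ‖f (p.2 * p.1)‖ₑ)) (by fun_prop)
  have hfin := kern_fin (fun u => ‖h u‖ₑ) _ hh.enorm hgm hh'.2.ne (by
    refine ne_top_of_le_ne_top ?_ (kern_bound (fun u => ‖k u‖ₑ) (fun y => ‖f y‖ₑ) hk.enorm hf.enorm)
    refine ENNReal.mul_ne_top (ENNReal.pow_ne_top hk'.2.ne) ?_
    rw [← eLpNorm_two_sq]; exact ENNReal.pow_ne_top hf'.2.ne)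
  filter_upwards [hfin] with x hx
  set E : ℝ → ℝ → ℂ := fun u t => h u * k (t / u) * ((u⁻¹ : ℝ) : ℂ) *
    (((t ^ (1/2:ℝ) : ℝ) : ℂ) * f (t * x)) with hE
  have key : ∀ u v : ℝ, 0 < u → 0 < v → (u : ℂ) * E u (u * v) =
      h u * (((u ^ (1/2:ℝ) : ℝ) : ℂ) * (k v * (((v ^ (1/2:ℝ) : ℝ) : ℂ) * f (v * (u * x))))) := by
    intro u v hu hv
    simp only [hE]
    rw [Real.mul_rpow hu.le hv.le, mul_div_cancel_left₀ _ hu.ne',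
      show u * v * x = v * (u * x) by ring]
    have : (u:ℂ) ≠ 0 := by exact_mod_cast hu.ne'
    push_cast
    field_simp
  have hEm : Measurable (Function.uncurry E) := by
    have : Function.uncurry E = fun p : ℝ × ℝ => h p.1 * k (p.2 / p.1) * ((p.1⁻¹ : ℝ) : ℂ) *
      (((p.2 ^ (1/2:ℝ) : ℝ) : ℂ) * f (p.2 * x)) := rfl
    rw [this]
    fun_prop
  have hEint : Integrable (Function.uncurry E) (muP.prod muP) := by
    refine ⟨hEm.aestronglyMeasurable, ?_⟩
    rw [hasFiniteIntegral_iff_enorm, lintegral_prod _ hEm.enorm.aemeasurable]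
    refine lt_of_eq_of_lt ?_ hx
    refine setLIntegral_congr_fun measurableSet_Ioi fun u hu => ?_
    have hu : 0 < u := hu
    have hEu : Measurable (E u) := hEm.of_uncurry_left
    change ∫⁻ t in Set.Ioi 0, ‖E u t‖ₑ = _
    rw [← lintegral_scale_Ioi (fun t => ‖E u t‖ₑ) hEu.enorm u hu, ← lintegral_const_mul _ (by fun_prop),
      ← lintegral_const_mul _ (by fun_prop), ← lintegral_const_mul _ (by fun_prop)]
    refine setLIntegral_congr_fun measurableSet_Ioi fun v hv => ?_
    have h1 := congrArg enorm (key u v hu hv)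
    have hr : ∀ r : ℝ, 0 < r → ‖(r : ℂ)‖ₑ = ENNReal.ofReal r := by
      intro r hr
      rw [← ofReal_norm, Complex.norm_real, Real.norm_of_nonneg hr.le]
    simp only [enorm_mul] at h1
    rw [hr u hu, hr _ (Real.rpow_pos_of_pos hu _), hr _ (Real.rpow_pos_of_pos hv _)] at h1
    exact h1
  have e1 : tfun h (tfun k f) x = ∫ u in Set.Ioi 0, ∫ t in Set.Ioi 0, E u t := by
    refine setIntegral_congr_fun measurableSet_Ioi fun u hu => ?_
    have hu : 0 < u := hu
    have h2 := integral_comp_mul_left_Ioi (E u) 0 hu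
    rw [mul_zero] at h2
    have h3 : ∫ t in Set.Ioi 0, E u t = (u:ℂ) * ∫ v in Set.Ioi 0, E u (u * v) := by
      rw [h2, Complex.real_smul, ← mul_assoc]
      have : (u:ℂ) ≠ 0 := by exact_mod_cast hu.ne'
      push_cast
      rw [mul_inv_cancel₀ this, one_mul]
    simp only [tfun]
    rw [h3, ← integral_const_mul, ← integral_const_mul, ← integral_const_mul]
    refine setIntegral_congr_fun measurableSet_Ioi fun v hv => ?_
    exact (key u v hu hv).symm
  rw [e1, integral_integral_swap hEint]
  refine setIntegral_congr_fun measurableSet_Ioi fun t ht => ?_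
  simp only [hE]
  rw [integral_mul_const, hconv t ht]

lemma TOp_comp (h k m : ℝ → ℂ) (hh : Measurable h) (hk : Measurable k)
    (hh' : Integrable h muP) (hk' : Integrable k muP) (hm' : Integrable m muP)
    (hconv : ∀ t, 0 < t → ∫ u in Set.Ioi 0, h u * k (t / u) * ((u⁻¹ : ℝ) : ℂ) = m t) :
    TOp (hh'.toL1 h) * TOp (hk'.toL1 k) = TOp (hm'.toL1 m) := by
  ext1 f
  apply Lp.ext
  have hk2 : TOp (hk'.toL1 k) f =ᵐ[volume] tfun k f := by
    filter_upwards [TOp_coe (hk'.toL1 k) f] with x hx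
    rw [hx, tfun_congr_left _ _ _ hk'.coeFn_toL1]
  filter_upwards [TOp_coe (hh'.toL1 h) (TOp (hk'.toL1 k) f), TOp_coe (hm'.toL1 m) f, ae_ne_zero,
    tfun_comp h k m f hh hk f.meas hh' hk' (Lp.memLp f) hconv] with x h1 h2 hx h3
  change TOp (hh'.toL1 h) (TOp (hk'.toL1 k) f) x = _
  rw [h1, h2, tfun_congr_left _ _ _ hh'.coeFn_toL1, tfun_congr_left _ _ _ hm'.coeFn_toL1,
    tfun_congr_right _ _ _ hk2 x hx, h3]

/-- The weights attached to `1 / (z - a)`. -/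
def kerA (a : ℂ) (u : ℝ) : ℂ :=
  if a.re < 1/2 then (if u < 1 then (u:ℂ) ^ (-a - 1/2) else 0)
  else (if u < 1 then 0 else -(u:ℂ) ^ (-a - 1/2))

lemma kerA_meas (a : ℂ) : Measurable (kerA a) := by
  unfold kerA
  split_ifs
  · exact Measurable.ite measurableSet_Iio (by fun_prop) measurable_const
  · exact Measurable.ite measurableSet_Iio measurable_const (by fun_prop)

lemma kerA_int (a : ℂ) (ha : a.re ≠ 1/2) : Integrable (kerA a) muP := by
  rcases lt_or_gt_of_ne ha with h | h
  · have h1 : IntegrableOn (fun u : ℝ => (u:ℂ) ^ (-a - 1/2)) (Set.Ioo 0 1) := by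
      rw [intervalIntegral.integrableOn_Ioo_cpow_iff one_pos]
      simp; linarith
    have h2 : kerA a = (Set.Iio 1).indicator (fun u : ℝ => (u:ℂ) ^ (-a - 1/2)) := by
      ext u
      simp only [kerA, if_pos h, Set.indicator_apply, Set.mem_Iio]
    rw [h2, integrable_indicator_iff measurableSet_Iio, IntegrableOn,
      Measure.restrict_restrict measurableSet_Iio, Set.inter_comm]
    exact h1
  · have h1 : IntegrableOn (fun u : ℝ => -(u:ℂ) ^ (-a - 1/2)) (Set.Ici 1) := by
      rw [integrableOn_Ici_iff_integrableOn_Ioi]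
      refine (integrableOn_Ioi_cpow_of_lt ?_ one_pos).neg
      simp; linarith
    have h2 : kerA a = (Set.Ici 1).indicator (fun u : ℝ => -(u:ℂ) ^ (-a - 1/2)) := by
      ext u
      simp only [kerA, if_neg h.le.not_gt, Set.indicator_apply, Set.mem_Ici]
      split_ifs <;> first | rfl | (exfalso; linarith)
    rw [h2, integrable_indicator_iff measurableSet_Ici, IntegrableOn,
      Measure.restrict_restrict measurableSet_Ici]
    exact h1.mono_set Set.inter_subset_left

lemma kerA_mellin (a z : ℂ) (ha : a.re ≠ 1/2) (hz : z.re = 1/2) :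
    ∫ u in Set.Ioi 0, kerA a u * (u:ℂ) ^ (z - 1/2) = (z - a)⁻¹ := by
  have hza : z - a ≠ 0 := by
    intro h
    have := congrArg re h
    simp only [sub_re, zero_re] at this
    exact ha (by linarith)
  rcases lt_or_gt_of_ne ha with h | h
  · have e : ∫ u in Set.Ioi 0, kerA a u * (u:ℂ) ^ (z - 1/2) =
        ∫ u in Set.Ioi 0, (Set.Iio 1).indicator (fun u : ℝ => (u:ℂ) ^ (z - a - 1)) u := by
      refine setIntegral_congr_fun measurableSet_Ioi fun u hu => ?_
      have hu' : (u:ℂ) ≠ 0 := by exact_mod_cast (ne_of_gt hu : u ≠ 0)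
      simp only [kerA, if_pos h, Set.indicator_apply, Set.mem_Iio]
      split_ifs
      · rw [← Complex.cpow_add _ _ hu']; congr 1; ring
      · simp
    rw [e, setIntegral_indicator measurableSet_Iio]
    change ∫ u in Set.Ioo (0:ℝ) 1, _ = _
    rw [← integral_Ioc_eq_integral_Ioo, ← intervalIntegral.integral_of_le zero_le_one,
      integral_cpow (Or.inl (by simp; linarith))]
    simp [hza]
  · have e : ∫ u in Set.Ioi 0, kerA a u * (u:ℂ) ^ (z - 1/2) =
        ∫ u in Set.Ioi 0, (Set.Ici 1).indicator (fun u : ℝ => -(u:ℂ) ^ (z - a - 1)) u := by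
      refine setIntegral_congr_fun measurableSet_Ioi fun u hu => ?_
      have hu' : (u:ℂ) ≠ 0 := by exact_mod_cast (ne_of_gt hu : u ≠ 0)
      simp only [kerA, if_neg h.le.not_gt, Set.indicator_apply, Set.mem_Ici]
      split_ifs
      · exfalso; linarith
      · simp
      · rw [neg_mul, ← Complex.cpow_add _ _ hu']; congr 2; ring
      · exfalso; linarith
    rw [e, setIntegral_indicator measurableSet_Ici, (Set.inter_eq_self_of_subset_right
      (fun x (hx : (1:ℝ) ≤ x) => lt_of_lt_of_le one_pos hx) : Set.Ioi (0:ℝ) ∩ Set.Ici 1 = Set.Ici 1),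
      integral_Ici_eq_integral_Ioi, integral_neg,
      integral_Ioi_cpow_of_lt (by simp; linarith) one_pos]
    simp
    rw [neg_div, neg_neg, one_div]

lemma kerA_conv (a : ℂ) (ha : a.re ≠ 1/2) (ha0 : a ≠ 0) (t : ℝ) (ht : 0 < t) :
    ∫ u in Set.Ioi 0, kerA 0 u * kerA a (t / u) * ((u⁻¹ : ℝ) : ℂ) =
      a⁻¹ * (kerA a t - kerA 0 t) := by
  have hpt : ∀ u : ℝ, 0 < u → (u:ℂ) ^ (-(0:ℂ) - 1/2) * ((t / u : ℝ) : ℂ) ^ (-a - 1/2) * ((u⁻¹ : ℝ) : ℂ)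
      = (t:ℂ) ^ (-a - 1/2) * (u:ℂ) ^ (a - 1) := by
    intro u hu
    have hu' : (u:ℂ) ≠ 0 := by exact_mod_cast (ne_of_gt hu : u ≠ 0)
    rw [div_eq_mul_inv t u, Complex.ofReal_mul, Complex.mul_cpow_ofReal_nonneg ht.le (by positivity),
      Complex.ofReal_inv, Complex.inv_cpow _ _ (by rw [Complex.arg_ofReal_of_nonneg hu.le]; exact Real.pi_pos.ne),
      ← Complex.cpow_neg]
    rw [show (u:ℂ)⁻¹ = (u:ℂ) ^ (-1:ℂ) by rw [Complex.cpow_neg_one]]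
    calc _ = (t:ℂ) ^ (-a - 1/2) * ((u:ℂ) ^ (-(0:ℂ) - 1/2) * (u:ℂ) ^ (-(-a - 1/2)) * (u:ℂ) ^ (-1:ℂ)) := by ring
      _ = _ := by
        rw [← Complex.cpow_add _ _ hu', ← Complex.cpow_add _ _ hu']; congr 2; ring
  have ht' : (t:ℂ) ≠ 0 := by exact_mod_cast ht.ne'
  have htp : (t:ℂ) ^ (-a - 1/2) * (t:ℂ) ^ a = (t:ℂ) ^ (-(0:ℂ) - 1/2) := by
    rw [← Complex.cpow_add _ _ ht']; congr 1; ring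
  have h0 : (0:ℂ).re < 1/2 := by simp
  rcases lt_or_gt_of_ne ha with h | h
  · have e : ∫ u in Set.Ioi 0, kerA 0 u * kerA a (t / u) * ((u⁻¹ : ℝ) : ℂ) =
        ∫ u in Set.Ioi 0, (Set.Ioo t 1).indicator
          (fun u : ℝ => (t:ℂ) ^ (-a - 1/2) * (u:ℂ) ^ (a - 1)) u := by
      refine setIntegral_congr_fun measurableSet_Ioi fun u hu => ?_
      have hu : 0 < u := hu
      have hd : t / u < 1 ↔ t < u := div_lt_one hu
      simp only [kerA, if_pos h, if_pos h0, Set.indicator_apply, Set.mem_Ioo, hd]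
      by_cases h1 : u < 1 <;> by_cases h2 : t < u <;> simp only [h1, h2, if_true, if_false, and_self,
        and_true, true_and, and_false, false_and, zero_mul, mul_zero]
      exact hpt u hu
    rw [e, setIntegral_indicator measurableSet_Ioo, (Set.inter_eq_self_of_subset_right
      (fun x hx => ht.trans hx.1) : Set.Ioi (0:ℝ) ∩ Set.Ioo t 1 = Set.Ioo t 1)]
    simp only [kerA, if_pos h, if_pos h0]
    by_cases h1 : t < 1
    · rw [← integral_Ioc_eq_integral_Ioo, ← intervalIntegral.integral_of_le h1.le,
        intervalIntegral.integral_const_mul,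
        integral_cpow (Or.inr ⟨by simpa [sub_eq_iff_eq_add] using ha0, by
          rw [Set.uIcc_of_le h1.le]; intro hc; exact absurd hc.1 (not_le.2 ht)⟩)]
      rw [if_pos h1, if_pos h1, ← htp]
      simp
      field_simp
    · rw [if_neg h1, if_neg h1, Set.Ioo_eq_empty h1]
      simp
  · have e : ∫ u in Set.Ioi 0, kerA 0 u * kerA a (t / u) * ((u⁻¹ : ℝ) : ℂ) =
        ∫ u in Set.Ioi 0, (Set.Iio 1 ∩ Set.Iic t).indicator
          (fun u : ℝ => -((t:ℂ) ^ (-a - 1/2) * (u:ℂ) ^ (a - 1))) u := by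
      refine setIntegral_congr_fun measurableSet_Ioi fun u hu => ?_
      have hu : 0 < u := hu
      have hd : t / u < 1 ↔ ¬ (u ≤ t) := by rw [div_lt_one hu, not_le]
      simp only [kerA, if_neg h.le.not_gt, if_pos h0, Set.indicator_apply, Set.mem_inter_iff,
        Set.mem_Iio, Set.mem_Iic, hd]
      by_cases h1 : u < 1 <;> by_cases h2 : u ≤ t <;> simp only [h1, h2, if_true, if_false, and_self,
        and_true, true_and, and_false, false_and, zero_mul, mul_zero, not_true, not_false_iff]
      rw [← hpt u hu]; ring
    have hI : ∀ c : ℝ, 0 < c → ∫ u in Set.Ioc 0 c, -((t:ℂ) ^ (-a - 1/2) * (u:ℂ) ^ (a - 1)) =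
        -((t:ℂ) ^ (-a - 1/2) * ((c:ℂ) ^ a / a)) := by
      intro c hc
      rw [← intervalIntegral.integral_of_le hc.le, intervalIntegral.integral_neg,
        intervalIntegral.integral_const_mul, integral_cpow (Or.inl (by simp; linarith))]
      simp [ha0]
    rw [e, setIntegral_indicator (measurableSet_Iio.inter measurableSet_Iic)]
    simp only [kerA, if_neg h.le.not_gt, if_pos h0]
    by_cases h1 : t < 1
    · have : Set.Ioi 0 ∩ (Set.Iio 1 ∩ Set.Iic t) = Set.Ioc 0 t := by
        ext u; simp only [Set.mem_inter_iff, Set.mem_Ioi, Set.mem_Iio, Set.mem_Iic, Set.mem_Ioc]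
        constructor
        · rintro ⟨p, q, r⟩; exact ⟨p, r⟩
        · rintro ⟨p, r⟩; exact ⟨p, r.trans_lt h1, r⟩
      rw [this, hI t ht, if_pos h1, if_pos h1, ← htp]
      field_simp
      ring
    · have : Set.Ioi 0 ∩ (Set.Iio 1 ∩ Set.Iic t) = Set.Ioo 0 1 := by
        ext u; simp only [Set.mem_inter_iff, Set.mem_Ioi, Set.mem_Iio, Set.mem_Iic, Set.mem_Ioo]
        constructor
        · rintro ⟨p, q, r⟩; exact ⟨p, q⟩
        · rintro ⟨p, r⟩; exact ⟨p, r, by linarith⟩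
      rw [this, ← integral_Ioc_eq_integral_Ioo, hI 1 one_pos, if_neg h1, if_neg h1]
      simp
      field_simp

open Classical in
def HL (a : ℂ) : L1P := if hi : Integrable (kerA a) muP then hi.toL1 (kerA a) else 0

lemma HL_eq (a : ℂ) (ha : a.re ≠ 1/2) : HL a = (kerA_int a ha).toL1 (kerA a) := by
  unfold HL
  rw [dif_pos (kerA_int a ha)]

lemma zero_re_ne : (0:ℂ).re ≠ 1/2 := by simp

lemma kerA_norm (a : ℂ) (u : ℝ) (hu : 0 < u) :
    ‖kerA a u‖ = if a.re < 1/2 then (if u < 1 then u ^ (-a.re - 1/2) else 0)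
      else (if u < 1 then 0 else u ^ (-a.re - 1/2)) := by
  unfold kerA
  split_ifs <;> simp [Complex.norm_cpow_eq_rpow_re_of_pos hu]

lemma kerA_le (a a0 : ℂ) (u : ℝ) (hu : 0 < u)
    (h : (a.re ≤ a0.re ∧ a0.re < 1/2) ∨ (1/2 < a0.re ∧ a0.re ≤ a.re)) :
    ‖kerA a u‖ ≤ ‖kerA a0 u‖ := by
  rw [kerA_norm _ _ hu, kerA_norm _ _ hu]
  rcases h with ⟨h1, h2⟩ | ⟨h1, h2⟩
  · rw [if_pos h2, if_pos (h1.trans_lt h2)]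
    split_ifs with h3
    · exact Real.rpow_le_rpow_of_exponent_ge hu h3.le (by linarith)
    · exact le_rfl
  · rw [if_neg h1.le.not_gt, if_neg (h1.le.trans h2).not_gt]
    split_ifs with h3
    · exact le_rfl
    · exact Real.rpow_le_rpow_of_exponent_le (not_lt.1 h3) (by linarith)

lemma kerA_tendsto (a0 : ℂ) (ha : a0.re ≠ 1/2) (u : ℝ) (hu : 0 < u) :
    Tendsto (fun a => kerA a u) (nhds a0) (nhds (kerA a0 u)) := by
  have hu' : (u:ℂ) ≠ 0 := by exact_mod_cast hu.ne'
  have hc : ContinuousAt (fun a : ℂ => (u:ℂ) ^ (-a - 1/2)) a0 := by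
    apply ContinuousAt.const_cpow
    · fun_prop
    · exact Or.inl hu'
  rcases lt_or_gt_of_ne ha with h | h
  · have hev : ∀ᶠ a in nhds a0, a.re < 1/2 :=
      Complex.continuous_re.continuousAt.eventually_lt continuousAt_const h
    have : (fun a => kerA a u) =ᶠ[nhds a0] fun a => if u < 1 then (u:ℂ) ^ (-a - 1/2) else 0 := by
      filter_upwards [hev] with a h
      simp only [kerA, if_pos h]
    refine ContinuousAt.congr ?_ this.symm
    split_ifs
    · exact hc
    · exact continuousAt_const
  · have hev : ∀ᶠ a in nhds a0, 1/2 < a.re :=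
      continuousAt_const.eventually_lt Complex.continuous_re.continuousAt h
    have : (fun a => kerA a u) =ᶠ[nhds a0] fun a => if u < 1 then 0 else -(u:ℂ) ^ (-a - 1/2) := by
      filter_upwards [hev] with a h
      simp only [kerA, if_neg h.le.not_gt]
    refine ContinuousAt.congr ?_ this.symm
    split_ifs
    · exact continuousAt_const
    · exact hc.neg

lemma HL_cont (a0 : ℂ) (ha : a0.re ≠ 1/2) : ContinuousAt HL a0 := by
  obtain ⟨b, hb, hev, hb0⟩ : ∃ b : ℂ, b.re ≠ 1/2 ∧ (∀ᶠ a in nhds a0,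
      (a.re ≤ b.re ∧ b.re < 1/2) ∨ (1/2 < b.re ∧ b.re ≤ a.re)) ∧
      ((a0.re ≤ b.re ∧ b.re < 1/2) ∨ (1/2 < b.re ∧ b.re ≤ a0.re)) := by
    rcases lt_or_gt_of_ne ha with h | h
    · refine ⟨(((a0.re + 1/2) / 2 : ℝ) : ℂ), ?_, ?_, ?_⟩
      · rw [Complex.ofReal_re]; linarith
      · have : a0.re < (a0.re + 1/2) / 2 := by linarith
        filter_upwards [Complex.continuous_re.continuousAt.eventually_lt continuousAt_const this] with a ha
        left
        rw [Complex.ofReal_re]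
        exact ⟨ha.le, by linarith⟩
      · left; rw [Complex.ofReal_re]; constructor <;> linarith
    · refine ⟨(((a0.re + 1/2) / 2 : ℝ) : ℂ), ?_, ?_, ?_⟩
      · rw [Complex.ofReal_re]; linarith
      · have : (a0.re + 1/2) / 2 < a0.re := by linarith
        filter_upwards [continuousAt_const.eventually_lt Complex.continuous_re.continuousAt this] with a ha
        right
        rw [Complex.ofReal_re]
        exact ⟨by linarith, ha.le⟩
      · right; rw [Complex.ofReal_re]; constructor <;> linarith
  have hne : ∀ a : ℂ, ((a.re ≤ b.re ∧ b.re < 1/2) ∨ (1/2 < b.re ∧ b.re ≤ a.re)) → a.re ≠ 1/2 := by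
    intro a h
    rcases h with ⟨h1, h2⟩ | ⟨h1, h2⟩ <;> intro h3 <;> linarith
  rw [ContinuousAt, tendsto_iff_norm_sub_tendsto_zero]
  have h1 : ∀ᶠ a in nhds a0, ∫ u in Set.Ioi 0, ‖kerA a u - kerA a0 u‖ = ‖HL a - HL a0‖ := by
    filter_upwards [hev] with a ha'
    rw [HL_eq a (hne a ha'), HL_eq a0 ha, ← Integrable.toL1_sub, L1.norm_of_fun_eq_integral_norm]
    rfl
  refine Tendsto.congr' h1 ?_
  have h2 : ∫ u in Set.Ioi (0:ℝ), (0:ℝ) = 0 := by simp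
  suffices h3 : Tendsto (fun a => ∫ u in Set.Ioi 0, ‖kerA a u - kerA a0 u‖) (nhds a0)
      (nhds (∫ u in Set.Ioi (0:ℝ), (0:ℝ))) by rwa [h2] at h3
  refine tendsto_integral_filter_of_dominated_convergence (fun u => ‖kerA b u‖ + ‖kerA b u‖) ?_ ?_ ?_ ?_
  · exact Eventually.of_forall fun a => ((kerA_meas a).sub (kerA_meas a0)).norm.aestronglyMeasurable
  · filter_upwards [hev] with a ha'
    filter_upwards [ae_restrict_mem measurableSet_Ioi] with u hu
    rw [norm_norm]
    exact (norm_sub_le _ _).trans (add_le_add (kerA_le _ _ u hu ha') (kerA_le _ _ u hu hb0))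
  · exact (kerA_int b hb).norm.add (kerA_int b hb).norm
  · filter_upwards [ae_restrict_mem measurableSet_Ioi] with u hu
    have := (kerA_tendsto a0 ha u hu)
    rw [tendsto_iff_norm_sub_tendsto_zero] at this
    exact this

lemma TOp_rel (a : ℂ) (ha : a.re ≠ 1/2) (ha0 : a ≠ 0) :
    TOp (HL 0) * TOp (HL a) = a⁻¹ • (TOp (HL a) - TOp (HL 0)) := by
  have hm : Integrable (a⁻¹ • (kerA a - kerA 0)) muP :=
    ((kerA_int a ha).sub (kerA_int 0 zero_re_ne)).smul a⁻¹
  rw [HL_eq a ha, HL_eq 0 zero_re_ne, TOp_comp _ _ _ (kerA_meas 0) (kerA_meas a) _ _ hm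
    (fun t ht => kerA_conv a ha ha0 t ht), Integrable.toL1_smul' _
      ((kerA_int a ha).sub (kerA_int 0 zero_re_ne)), Integrable.toL1_sub _ _ (kerA_int a ha)
      (kerA_int 0 zero_re_ne), map_smul, map_sub]

lemma cesaro_eq (C : L2 →L[ℂ] L2) (hC : IsCesaroOp C) : C = TOp (HL 0) := by
  ext1 f
  apply Lp.ext
  filter_upwards [hC f, TOp_coe (HL 0) f] with x h1 h2
  rw [h1, h2, HL_eq 0 zero_re_ne, tfun_congr_left _ _ _ (kerA_int 0 zero_re_ne).coeFn_toL1]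
  have : Set.Ioo (0:ℝ) 1 = Set.Ioi 0 ∩ Set.Iio 1 := rfl
  rw [this, ← setIntegral_indicator measurableSet_Iio]
  refine setIntegral_congr_fun measurableSet_Ioi fun u hu => ?_
  have hu : 0 < u := hu
  have hu' : (u:ℂ) ≠ 0 := by exact_mod_cast hu.ne'
  simp only [Set.indicator_apply, Set.mem_Iio, kerA, if_pos (show (0:ℂ).re < 1/2 by simp)]
  split_ifs
  · rw [Complex.ofReal_cpow hu.le, ← mul_assoc, ← Complex.cpow_add _ _ hu']
    norm_num
  · simp

lemma resolvent_eq (C : L2 →L[ℂ] L2) (hC : IsCesaroOp C) (hN : IsStarNormal C)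
    (hσ : spectrum ℂ C = Metric.sphere (1:ℂ) 1) (l : ℂ) (hl : l⁻¹.re ≠ 1/2) (hl0 : l ≠ 0)
    (hls : l ∉ Metric.sphere (1:ℂ) 1) :
    cfc (fun w : ℂ => (l - w)⁻¹) C = l⁻¹ • (1 : L2 →L[ℂ] L2) + (l⁻¹ ^ 2) • TOp (HL l⁻¹) := by
  have hne : ∀ w ∈ spectrum ℂ C, l - w ≠ 0 := by
    intro w hw h
    rw [hσ] at hw
    exact hls (by rwa [sub_eq_zero.1 h])
  have h1 : cfc (fun w : ℂ => l - w) C = l • (1 : L2 →L[ℂ] L2) - C := by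
    rw [cfc_sub (fun _ => l) (fun w => w) C, cfc_const l C, cfc_id' ℂ C, Algebra.algebraMap_eq_smul_one]
  have h2 : cfc (fun w : ℂ => (l - w)⁻¹) C * cfc (fun w : ℂ => l - w) C = 1 := by
    rw [← cfc_mul (fun w : ℂ => (l - w)⁻¹) (fun w : ℂ => l - w) C
      (ContinuousOn.inv₀ (by fun_prop) hne) (by fun_prop), ← cfc_one ℂ C]
    exact cfc_congr fun w hw => inv_mul_cancel₀ (hne w hw)
  refine left_inv_eq_right_inv h2 ?_
  have h3 := TOp_rel l⁻¹ hl (inv_ne_zero hl0)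
  rw [← cesaro_eq C hC, inv_inv] at h3
  rw [h1, sub_mul, mul_add, mul_add, mul_smul_comm, mul_smul_comm, mul_smul_comm, mul_smul_comm, h3,
    mul_one, mul_one, smul_mul_assoc, one_mul, smul_smul, smul_smul, smul_smul, smul_sub]
  rw [inv_mul_cancel₀ hl0, one_smul]
  have e : l⁻¹ ^ 2 * l = l⁻¹ := by field_simp
  rw [e]
  abel

lemma mem_sphere_one (w : ℂ) : w ∈ Metric.sphere (1:ℂ) 1 ↔ normSq w = 2 * w.re := by
  rw [mem_sphere_iff_norm]
  have : ‖w - 1‖ = 1 ↔ ‖w - 1‖ ^ 2 = 1 := by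
    constructor
    · intro h; rw [h]; norm_num
    · intro h
      have := norm_nonneg (w - 1)
      nlinarith
  rw [this, Complex.sq_norm, normSq_apply, normSq_apply]
  simp
  constructor <;> intro h <;> linarith

lemma inv_mem_sphere (z : ℂ) (hz : z.re = 1/2) : z⁻¹ ∈ Metric.sphere (1:ℂ) 1 := by
  rw [mem_sphere_one, Complex.inv_re, hz, map_inv₀]
  ring

lemma re_inv_ne (l : ℂ) (h0 : l ≠ 0) (h : l ∉ Metric.sphere (1:ℂ) 1) : l⁻¹.re ≠ 1/2 := by
  intro h1
  rw [Complex.inv_re] at h1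
  apply h
  rw [mem_sphere_one]
  have : normSq l ≠ 0 := by simpa using h0
  field_simp at h1
  linarith

lemma zero_mem_sphere : (0:ℂ) ∈ Metric.sphere (1:ℂ) 1 := by simp

lemma mel_norm (z : ℂ) (hz : z.re = 1/2) (u : ℝ) (hu : 0 < u) : ‖(u:ℂ) ^ (z - 1/2)‖ = 1 := by
  rw [Complex.norm_cpow_eq_rpow_re_of_pos hu]
  simp [hz]

lemma mel_int (z : ℂ) (hz : z.re = 1/2) (h : L1P) :
    Integrable (fun u : ℝ => h u * (u:ℂ) ^ (z - 1/2)) muP := by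
  refine h.int.norm.mono' (Measurable.aestronglyMeasurable (by have := h.meas; fun_prop)) ?_
  filter_upwards [ae_restrict_mem measurableSet_Ioi] with u hu
  rw [norm_mul, mel_norm z hz u hu, mul_one]

/-- The Mellin functional. -/
def mel (z : ℂ) (hz : z.re = 1/2) : L1P →L[ℂ] ℂ :=
  LinearMap.mkContinuous
    { toFun := fun h : L1P => ∫ u in Set.Ioi 0, h u * (u:ℂ) ^ (z - 1/2)
      map_add' := by
        intro h k
        rw [← integral_add (mel_int z hz h) (mel_int z hz k)]
        apply integral_congr_ae
        filter_upwards [Lp.coeFn_add h k] with u hu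
        rw [hu, Pi.add_apply, add_mul]
      map_smul' := by
        intro c h
        rw [RingHom.id_apply, ← integral_smul]
        apply integral_congr_ae
        filter_upwards [Lp.coeFn_smul c h] with u hu
        rw [hu, Pi.smul_apply, smul_mul_assoc] } 1 (by
    intro h
    rw [one_mul, L1.norm_eq_integral_norm]
    refine (norm_integral_le_integral_norm _).trans (le_of_eq ?_)
    refine setIntegral_congr_fun measurableSet_Ioi fun u hu => ?_
    simp only [norm_mul, mel_norm z hz u hu, mul_one])

lemma mel_apply (z : ℂ) (hz : z.re = 1/2) (h : L1P) :
    mel z hz h = ∫ u in Set.Ioi 0, h u * (u:ℂ) ^ (z - 1/2) := rfl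

lemma mel_HL (z : ℂ) (hz : z.re = 1/2) (a : ℂ) (ha : a.re ≠ 1/2) :
    mel z hz (HL a) = (z - a)⁻¹ := by
  rw [mel_apply, ← kerA_mellin a z ha hz, HL_eq a ha]
  apply integral_congr_ae
  filter_upwards [(kerA_int a ha).coeFn_toL1] with u hu
  rw [hu]

lemma cauchy_annulus (F : ℂ → ℂ) (U : Set ℂ) (hU : IsOpen U) (hF : DifferentiableOn ℂ F U)
    (r R : ℝ) (hr0 : 0 < r) (hr : r < 1) (hR : 1 < R)
    (hsub : Metric.closedBall (1:ℂ) R \ Metric.ball 1 r ⊆ U) (w : ℂ)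
    (hw : w ∈ Metric.sphere (1:ℂ) 1) :
    (∮ ζ in C(1, R), (ζ - w)⁻¹ * F ζ) - (∮ ζ in C(1, r), (ζ - w)⁻¹ * F ζ) =
      2 * Real.pi * I * F w := by
  have hw1 : dist w 1 = 1 := hw
  have hwU : w ∈ U := hsub ⟨by simp only [Metric.mem_closedBall]; linarith,
    by simp only [Metric.mem_ball]; linarith⟩
  have hd : DifferentiableOn ℂ (dslope F w) U :=
    (Complex.differentiableOn_dslope (hU.mem_nhds hwU)).2 hF
  have h1 := circleIntegral_eq_of_differentiable_on_annulus_off_countable (c := 1) hr0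
    (hr.trans hR).le (f := dslope F w) Set.countable_empty (hd.continuousOn.mono hsub) (by
      intro z hz
      refine hd.differentiableAt (hU.mem_nhds (hsub ⟨Metric.ball_subset_closedBall hz.1.1, fun h =>
        hz.1.2 (Metric.ball_subset_closedBall h)⟩)))
  have h2 : ∀ ρ : ℝ, 0 < ρ → ρ ≠ 1 → r ≤ ρ → ρ ≤ R → (∮ ζ in C(1, ρ), dslope F w ζ) =
      (∮ ζ in C(1, ρ), (ζ - w)⁻¹ * F ζ) - (∮ ζ in C(1, ρ), (ζ - w)⁻¹) * F w := by
    intro ρ h0 hne hl hu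
    have hnw : ∀ ζ ∈ Metric.sphere (1:ℂ) ρ, ζ ≠ w := by
      rintro ζ hζ rfl
      exact hne (by rw [← hw1]; exact hζ.symm)
    have hFc : ContinuousOn F (Metric.sphere (1:ℂ) ρ) := hF.continuousOn.mono (fun ζ hζ =>
      hsub ⟨by rw [Metric.mem_closedBall, Metric.mem_sphere.1 hζ]; exact hu,
        by rw [Metric.mem_ball, Metric.mem_sphere.1 hζ]; exact hl.not_gt⟩)
    have hic : ContinuousOn (fun ζ : ℂ => (ζ - w)⁻¹) (Metric.sphere (1:ℂ) ρ) :=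
      ContinuousOn.inv₀ (by fun_prop) (fun ζ hζ => sub_ne_zero.2 (hnw ζ hζ))
    have e : (∮ ζ in C(1, ρ), (ζ - w)⁻¹) * F w = ∮ ζ in C(1, ρ), (ζ - w)⁻¹ * F w := by
      rw [mul_comm, ← circleIntegral.integral_const_mul]
      simp_rw [mul_comm]
    rw [e, ← circleIntegral.integral_sub (f := fun ζ => (ζ - w)⁻¹ * F ζ)
      (g := fun ζ => (ζ - w)⁻¹ * F w) ((hic.mul hFc).circleIntegrable h0.le)
      ((hic.mul continuousOn_const).circleIntegrable h0.le)]
    refine circleIntegral.integral_congr h0.le fun ζ hζ => ?_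
    rw [dslope_of_ne _ (hnw ζ hζ), slope_def_module]
    simp [mul_sub]
  rw [h2 R (by linarith) (by linarith) (by linarith) le_rfl, h2 r hr0 (by linarith) le_rfl (by linarith)] at h1
  rw [circleIntegral.integral_sub_inv_of_mem_ball (by rw [Metric.mem_ball]; linarith)] at h1
  have h3 : (∮ ζ in C(1, r), (ζ - w)⁻¹) = 0 := by
    refine circleIntegral_eq_zero_of_differentiable_on_off_countable hr0.le Set.countable_empty ?_ ?_
    · refine ContinuousOn.inv₀ (by fun_prop) ?_
      rintro z hz h
      rw [sub_eq_zero.1 h, Metric.mem_closedBall] at hz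
      linarith
    · rintro z ⟨hz, -⟩
      refine DifferentiableAt.inv (by fun_prop) ?_
      intro h
      rw [sub_eq_zero.1 h, Metric.mem_ball] at hz
      linarith
  rw [h3] at h1
  linear_combination h1

lemma exists_annulus (U : Set ℂ) (hU : IsOpen U) (hsub : Metric.sphere (1:ℂ) 1 ⊆ U) :
    ∃ r R : ℝ, 0 < r ∧ r < 1 ∧ 1 < R ∧ Metric.closedBall (1:ℂ) R \ Metric.ball 1 r ⊆ U := by
  obtain ⟨δ, hδ, h⟩ := (isCompact_sphere (1:ℂ) 1).exists_cthickening_subset_open hU hsub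
  set d := min δ (1/2) with hd
  have hd0 : 0 < d := lt_min hδ (by norm_num)
  have hd1 : d ≤ δ := min_le_left _ _
  have hd2 : d ≤ 1/2 := min_le_right _ _
  refine ⟨1 - d, 1 + d, by linarith, by linarith, by linarith, fun z hz => h ?_⟩
  have h1 : ‖z - 1‖ ≤ 1 + d := by simpa [dist_eq_norm] using hz.1
  have h2 : 1 - d ≤ ‖z - 1‖ := by simpa [dist_eq_norm] using hz.2
  have hn : 0 < ‖z - 1‖ := by linarith
  have hn' : ((‖z - 1‖ : ℝ) : ℂ) ≠ 0 := by exact_mod_cast hn.ne'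
  refine Metric.mem_cthickening_of_dist_le z (1 + (z - 1) / (‖z - 1‖ : ℝ)) δ _ ?_ ?_
  · rw [mem_sphere_iff_norm]
    simp [hn.ne']
  · have e : z - (1 + (z - 1) / (‖z - 1‖ : ℝ)) = ((z - 1) / (‖z - 1‖ : ℝ)) * ((‖z - 1‖ - 1 : ℝ) : ℂ) := by
      push_cast
      field_simp
      ring
    rw [dist_eq_norm, e, norm_mul, norm_div, Complex.norm_real, Complex.norm_real, norm_norm,
      div_self hn.ne', one_mul, Real.norm_eq_abs, abs_le]
    constructor <;> linarith

/-- Kernel contribution of one circle. -/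
def GKer (F : ℂ → ℂ) (ρ : ℝ) : L1P := ∮ ζ in C(1, ρ), (F ζ * ζ⁻¹ ^ 2) • HL ζ⁻¹

lemma circ_facts (ρ : ℝ) (hne : ρ ≠ 1) (ζ : ℂ) (hζ : ζ ∈ Metric.sphere (1:ℂ) ρ) :
    ζ ≠ 0 ∧ ζ ∉ Metric.sphere (1:ℂ) 1 ∧ ζ⁻¹.re ≠ 1/2 := by
  have h1 : ζ ∉ Metric.sphere (1:ℂ) 1 := by
    intro h
    rw [Metric.mem_sphere] at h hζ
    exact hne (hζ.symm.trans h)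
  have h0 : ζ ≠ 0 := by
    rintro rfl
    exact h1 zero_mem_sphere
  exact ⟨h0, h1, re_inv_ne ζ h0 h1⟩

lemma GKer_contOn (F : ℂ → ℂ) (ρ : ℝ) (hne : ρ ≠ 1)
    (hF : ContinuousOn F (Metric.sphere (1:ℂ) ρ)) :
    ContinuousOn (fun ζ : ℂ => (F ζ * ζ⁻¹ ^ 2) • HL ζ⁻¹) (Metric.sphere (1:ℂ) ρ) := by
  have hi : ContinuousOn (fun ζ : ℂ => ζ⁻¹) (Metric.sphere (1:ℂ) ρ) :=
    continuousOn_id.inv₀ (fun ζ hζ => (circ_facts ρ hne ζ hζ).1)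
  refine ContinuousOn.smul (hF.mul (hi.pow 2)) ?_
  intro ζ hζ
  exact ContinuousAt.comp_continuousWithinAt (HL_cont _ (circ_facts ρ hne ζ hζ).2.2) (hi ζ hζ)

lemma GKer_mel (F : ℂ → ℂ) (ρ : ℝ) (h0 : 0 < ρ) (hne : ρ ≠ 1)
    (hF : ContinuousOn F (Metric.sphere (1:ℂ) ρ)) (z : ℂ) (hz : z.re = 1/2) :
    mel z hz (GKer F ρ) = (∮ ζ in C(1, ρ), (ζ - z⁻¹)⁻¹ * F ζ) - ∮ ζ in C(1, ρ), (ζ - 0)⁻¹ * F ζ := by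
  have hz0 : z ≠ 0 := by rintro rfl; simp at hz
  have hc : ∀ w ∈ Metric.sphere (1:ℂ) 1, CircleIntegrable (fun ζ => (ζ - w)⁻¹ * F ζ) 1 ρ := by
    intro w hw
    refine ContinuousOn.circleIntegrable h0.le (ContinuousOn.mul (ContinuousOn.inv₀ (by fun_prop) ?_) hF)
    intro ζ hζ h
    exact (circ_facts ρ hne ζ hζ).2.1 (by rwa [sub_eq_zero.1 h])
  rw [← circleIntegral.integral_sub (hc _ (inv_mem_sphere z hz)) (hc _ zero_mem_sphere)]
  have hci := ((GKer_contOn F ρ hne hF).circleIntegrable h0.le).out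
  unfold GKer circleIntegral
  refine (ContinuousLinearMap.intervalIntegral_comp_comm (mel z hz) hci).symm.trans ?_
  refine intervalIntegral.integral_congr fun θ _ => ?_
  have hm := circleMap_mem_sphere (1:ℂ) h0.le θ
  obtain ⟨a1, a2, a3⟩ := circ_facts ρ hne _ hm
  simp only [map_smul, mel_HL z hz _ a3, smul_eq_mul]
  congr 1
  have h1 : z - (circleMap 1 ρ θ)⁻¹ ≠ 0 := by
    intro h
    rw [← sub_eq_zero.1 h] at a3
    exact a3 hz
  have h2 : circleMap 1 ρ θ - z⁻¹ ≠ 0 := by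
    intro h
    rw [sub_eq_zero.1 h] at a2
    exact a2 (inv_mem_sphere z hz)
  generalize circleMap 1 ρ θ = y at *
  have h3 : z * y - 1 ≠ 0 := by
    intro h; apply h1
    have : z = y⁻¹ := eq_inv_of_mul_eq_one_left (sub_eq_zero.1 h)
    rw [this, sub_self]
  have e1 : z - y⁻¹ = (z * y - 1) / y := by field_simp
  have e2 : y - z⁻¹ = (z * y - 1) / z := by field_simp
  have e3 : z = ((z * y - 1) + 1) / y := by field_simp; ring
  rw [e1, e2, sub_zero, inv_div, inv_div]
  generalize z * y - 1 = m at h3 e3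
  rw [e3]
  field_simp
  ring

lemma cont_circ (F : ℂ → ℂ) (ρ : ℝ) (h0 : 0 < ρ) (hne : ρ ≠ 1)
    (hF : ContinuousOn F (Metric.sphere (1:ℂ) ρ)) :
    ContinuousOn (Function.uncurry fun (θ : ℝ) (w : ℂ) => deriv (circleMap 1 ρ) θ •
      ((circleMap 1 ρ θ - w)⁻¹ * F (circleMap 1 ρ θ))) (Set.univ ×ˢ Metric.sphere (1:ℂ) 1) := by
  have hFc : Continuous fun θ => F (circleMap 1 ρ θ) :=
    hF.comp_continuous (continuous_circleMap 1 ρ) (fun θ => circleMap_mem_sphere (1:ℂ) h0.le θ)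
  have hd : Continuous (deriv (circleMap 1 ρ)) := by
    have : deriv (circleMap 1 ρ) = fun θ => circleMap 0 ρ θ * I := by
      ext θ; exact deriv_circleMap 1 ρ θ
    rw [this]; fun_prop
  unfold Function.uncurry
  refine ContinuousOn.smul (hd.comp continuous_fst).continuousOn
    (ContinuousOn.mul (ContinuousOn.inv₀ (Continuous.continuousOn ?_) ?_) (hFc.comp continuous_fst).continuousOn)
  · exact ((continuous_circleMap 1 ρ).comp continuous_fst).sub continuous_snd
  · rintro ⟨θ, w⟩ ⟨-, hw⟩ h
    exact (circ_facts ρ hne _ (circleMap_mem_sphere (1:ℂ) h0.le θ)).2.1 (by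
      rw [sub_eq_zero.1 h]; exact hw)

lemma cont_circ_int (F : ℂ → ℂ) (ρ : ℝ) (h0 : 0 < ρ) (hne : ρ ≠ 1)
    (hF : ContinuousOn F (Metric.sphere (1:ℂ) ρ)) :
    ContinuousOn (fun w => ∮ ζ in C(1, ρ), (ζ - w)⁻¹ * F ζ) (Metric.sphere (1:ℂ) 1) := by
  rw [continuousOn_iff_continuous_domRestrict]
  have := cont_circ F ρ h0 hne hF
  refine intervalIntegral.continuous_parametric_intervalIntegral_of_continuous' (μ := volume)
    (f := fun (w : Metric.sphere (1:ℂ) 1) θ => deriv (circleMap 1 ρ) θ •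
      ((circleMap 1 ρ θ - w)⁻¹ * F (circleMap 1 ρ θ))) ?_ 0 (2 * Real.pi)
  exact this.comp_continuous (f := fun p : Metric.sphere (1:ℂ) 1 × ℝ => (p.2, (p.1 : ℂ)))
    (by fun_prop) (fun p => ⟨Set.mem_univ _, p.1.2⟩)

lemma cfc_circle (C : L2 →L[ℂ] L2) (hC : IsCesaroOp C) (hN : IsStarNormal C)
    (hσ : spectrum ℂ C = Metric.sphere (1:ℂ) 1) (F : ℂ → ℂ) (ρ : ℝ) (h0 : 0 < ρ) (hne : ρ ≠ 1)
    (hF : ContinuousOn F (Metric.sphere (1:ℂ) ρ)) :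
    cfc (fun w => ∮ ζ in C(1, ρ), (ζ - w)⁻¹ * F ζ) C =
      (∮ ζ in C(1, ρ), (ζ - 0)⁻¹ * F ζ) • (1 : L2 →L[ℂ] L2) + TOp (GKer F ρ) := by
  have hcont := cont_circ F ρ h0 hne hF
  have hpi : (0:ℝ) ≤ 2 * Real.pi := by positivity
  obtain ⟨B, hB⟩ := ((isCompact_Icc (a := (0:ℝ)) (b := 2 * Real.pi)).prod
    (isCompact_sphere (1:ℂ) 1)).exists_bound_of_continuousOn
      (hcont.mono (Set.prod_mono_left (Set.subset_univ _)))
  unfold circleIntegral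
  simp only [intervalIntegral.integral_of_le hpi]
  rw [cfc_setIntegral (μ := volume) measurableSet_Ioc (fun (θ : ℝ) (w : ℂ) => deriv (circleMap 1 ρ) θ •
      ((circleMap 1 ρ θ - w)⁻¹ * F (circleMap 1 ρ θ))) (fun _ => B) C
      (by rw [hσ]; exact hcont.mono (Set.prod_mono_left (Set.subset_univ _)))
      (by
        rw [hσ]
        filter_upwards [ae_restrict_mem measurableSet_Ioc] with θ hθ w hw
        exact hB (θ, w) ⟨Set.Ioc_subset_Icc_self hθ, hw⟩)
      (integrable_const B).2]
  have hint1 : CircleIntegrable (fun ζ : ℂ => (ζ - 0)⁻¹ * F ζ) 1 ρ := by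
    refine ContinuousOn.circleIntegrable h0.le (ContinuousOn.mul (ContinuousOn.inv₀ (by fun_prop) ?_) hF)
    intro ζ hζ h
    rw [sub_zero] at h
    exact (circ_facts ρ hne ζ hζ).1 h
  have hint2 := (GKer_contOn F ρ hne hF).circleIntegrable h0.le
  have e1 : (∫ θ in Set.Ioc 0 (2 * Real.pi), deriv (circleMap 1 ρ) θ •
      ((circleMap 1 ρ θ - 0)⁻¹ * F (circleMap 1 ρ θ))) • (1 : L2 →L[ℂ] L2) =
      ∫ θ in Set.Ioc 0 (2 * Real.pi), (deriv (circleMap 1 ρ) θ •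
      ((circleMap 1 ρ θ - 0)⁻¹ * F (circleMap 1 ρ θ))) • (1 : L2 →L[ℂ] L2) := by
    rw [integral_smul_const]
  have e2 : TOp (GKer F ρ) = ∫ θ in Set.Ioc 0 (2 * Real.pi), TOp (deriv (circleMap 1 ρ) θ •
      (F (circleMap 1 ρ θ) * (circleMap 1 ρ θ)⁻¹ ^ 2) • HL (circleMap 1 ρ θ)⁻¹) := by
    unfold GKer circleIntegral
    refine (ContinuousLinearMap.intervalIntegral_comp_comm TOp hint2.out).symm.trans ?_
    rw [intervalIntegral.integral_of_le hpi]
  have i1 := (intervalIntegrable_iff_integrableOn_Ioc_of_le hpi).1 hint1.out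
  have i2 := (intervalIntegrable_iff_integrableOn_Ioc_of_le hpi).1 hint2.out
  rw [e1, e2, ← integral_add (i1.smul_const _) (TOp.integrable_comp i2)]
  refine integral_congr_ae (Eventually.of_forall fun θ => ?_)
  have hm := circleMap_mem_sphere (1:ℂ) h0.le θ
  obtain ⟨a1, a2, a3⟩ := circ_facts ρ hne _ hm
  have hres := resolvent_eq C hC hN hσ _ a3 a1 a2
  have hcc : ContinuousOn (fun w : ℂ => (circleMap 1 ρ θ - w)⁻¹) (spectrum ℂ C) := by
    refine ContinuousOn.inv₀ (by fun_prop) ?_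
    intro w hw h
    rw [hσ] at hw
    exact a2 (by rwa [sub_eq_zero.1 h])
  have e3 : (fun w : ℂ => deriv (circleMap 1 ρ) θ • ((circleMap 1 ρ θ - w)⁻¹ * F (circleMap 1 ρ θ))) =
      fun w : ℂ => (deriv (circleMap 1 ρ) θ * F (circleMap 1 ρ θ)) * (circleMap 1 ρ θ - w)⁻¹ := by
    ext w; rw [smul_eq_mul]; ring
  simp only
  rw [e3, cfc_const_mul _ _ C hcc, hres, map_smul, map_smul, smul_add, smul_smul, smul_smul, smul_smul,
    sub_zero, smul_eq_mul]
  congr 2 <;> ring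

lemma kc_int (K : ℝ → ℂ) (hK : Measurable K) (h : HausdorffKernelCond K) (a b : ℝ) :
    IntervalIntegrable K volume a b := by
  rw [intervalIntegrable_iff]
  obtain ⟨N, hN⟩ : ∃ N : ℝ, ∀ u ∈ Set.uIoc a b, |u| ≤ N := by
    refine ⟨max |a| |b|, fun u hu => ?_⟩
    have := Set.uIoc_subset_uIcc hu
    rw [Set.mem_uIcc] at this
    rcases this with ⟨h1, h2⟩ | ⟨h1, h2⟩
    · exact abs_le_max_abs_abs h1 h2
    · rw [max_comm]; exact abs_le_max_abs_abs h1 h2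
  refine Integrable.mono' (g := fun u => (‖K u‖ * |u| ^ (-(1/2) : ℝ)) * N ^ (1/2 : ℝ))
    (h.mul_const _).integrableOn hK.aestronglyMeasurable ?_
  filter_upwards [ae_restrict_mem measurableSet_uIoc, ae_restrict_of_ae ae_ne_zero] with u hu hu0
  have hp : 0 < |u| := abs_pos.2 hu0
  rw [mul_assoc]
  refine le_mul_of_one_le_right (norm_nonneg _) ?_
  calc (1:ℝ) = |u| ^ (-(1/2) : ℝ) * |u| ^ (1/2 : ℝ) := by
        rw [← Real.rpow_add hp]; norm_num
    _ ≤ _ := by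
        gcongr
        exact hN u hu

lemma kc_loc (K : ℝ → ℂ) (hK : Measurable K) (h : HausdorffKernelCond K) :
    LocallyIntegrable K := by
  intro x
  refine ⟨Set.Ioc (x-1) (x+1), Ioc_mem_nhds (by linarith) (by linarith), ?_⟩
  exact (intervalIntegrable_iff_integrableOn_Ioc_of_le (by linarith)).1 (kc_int K hK h _ _)

/-- The indicator of the unit interval in `L²`. -/
def indU : L2 := indicatorConstLp 2 (s := Set.Ioc (0:ℝ) 1) measurableSet_Ioc (by simp) (1:ℂ)

lemma indU_int (K : ℝ → ℂ) (x : ℝ) (hx : x ≠ 0) :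
    ∫ u : ℝ, K u * indU (u * x) = (if 0 < x then 1 else -1) * ∫ u in (0:ℝ)..x⁻¹, K u := by
  have h1 : ∀ᵐ y : ℝ, indU y = (Set.Ioc (0:ℝ) 1).indicator (fun _ => (1:ℂ)) y :=
    indicatorConstLp_coeFn
  have h2 := ae_scale h1 x hx
  have h3 : ∫ u : ℝ, K u * indU (u * x) =
      ∫ u : ℝ, K u * (Set.Ioc (0:ℝ) 1).indicator (fun _ => (1:ℂ)) (u * x) := by
    refine integral_congr_ae ?_
    filter_upwards [h2] with u hu
    rw [hu]
  rw [h3]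
  rcases lt_or_gt_of_ne hx with hx | hx
  · rw [if_neg (not_lt.2 hx.le)]
    rw [intervalIntegral.integral_of_ge (by simpa using hx.le), neg_mul_neg, one_mul,
      ← integral_Ico_eq_integral_Ioc,
      ← integral_indicator measurableSet_Ico]
    refine integral_congr_ae (Eventually.of_forall fun u => ?_)
    have : u * x ∈ Set.Ioc (0:ℝ) 1 ↔ u ∈ Set.Ico x⁻¹ 0 := by
      simp only [Set.mem_Ioc, Set.mem_Ico]
      rw [show 0 < u * x ↔ u < 0 from ⟨fun h => neg_of_mul_pos_left h hx.le, fun h => mul_pos_of_neg_of_neg h hx⟩, inv_eq_one_div, div_le_iff_of_neg hx]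
      tauto
    by_cases hu : u ∈ Set.Ico x⁻¹ 0
    · simp [Set.indicator, hu, this.2 hu]
    · simp only [Set.indicator, hu, mt this.1 hu, if_false, mul_zero]
  · rw [if_pos hx]
    rw [intervalIntegral.integral_of_le (by simpa using hx.le), one_mul,
      ← integral_indicator measurableSet_Ioc]
    refine integral_congr_ae (Eventually.of_forall fun u => ?_)
    have : u * x ∈ Set.Ioc (0:ℝ) 1 ↔ u ∈ Set.Ioc 0 x⁻¹ := by
      simp only [Set.mem_Ioc]
      rw [mul_pos_iff_of_pos_right hx, inv_eq_one_div, le_div_iff₀ hx]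
    by_cases hu : u ∈ Set.Ioc 0 x⁻¹
    · simp [Set.indicator, hu, this.2 hu]
    · simp only [Set.indicator, hu, mt this.1 hu, if_false, mul_zero]

lemma haus_unique (K K' : ℝ → ℂ) (hK : Measurable K) (hK' : Measurable K')
    (h : HausdorffKernelCond K) (h' : HausdorffKernelCond K') (T : L2 →L[ℂ] L2)
    (hT : IsHausdorffOp K T) (hT' : IsHausdorffOp K' T) : K' =ᵐ[volume] K := by
  have hL : LocallyIntegrable (fun u => K' u - K u) :=
    (kc_loc K' hK' h').sub (kc_loc K hK h)
  have hi : ∀ a b, IntervalIntegrable (fun u => K' u - K u) volume a b := fun a b =>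
    (kc_int K' hK' h' a b).sub (kc_int K hK h a b)
  set g : ℝ → ℂ := fun c => ∫ u in (0:ℝ)..c, (K' u - K u) with hg
  have hgc : Continuous g := intervalIntegral.continuous_primitive hi 0
  have hae : ∀ᵐ x : ℝ, x ≠ 0 ∧ g x⁻¹ = 0 := by
    filter_upwards [ae_ne_zero, hT indU, hT' indU] with x hx e1 e2
    refine ⟨hx, ?_⟩
    rw [e1, indU_int _ _ hx, indU_int _ _ hx] at e2
    have h1 : (if 0 < x then (1:ℂ) else -1) ≠ 0 := by split_ifs <;> norm_num
    have e3 := mul_left_cancel₀ h1 e2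
    rw [hg]
    simp only
    rw [intervalIntegral.integral_sub (kc_int K' hK' h' _ _) (kc_int K hK h _ _), e3, sub_self]
  have hd := Measure.dense_of_ae hae
  have hg0 : ∀ c, g c = 0 := by
    intro c
    by_cases hc : c = 0
    · simp [hg, hc]
    have hca : ContinuousAt (fun x : ℝ => g x⁻¹) c⁻¹ :=
      hgc.continuousAt.comp (continuousAt_inv₀ (inv_ne_zero hc))
    have hm := mem_closure_image hca (hd c⁻¹)
    have hsub : (fun x : ℝ => g x⁻¹) '' {x | x ≠ 0 ∧ g x⁻¹ = 0} ⊆ {0} := by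
      rintro _ ⟨x, hx, rfl⟩
      exact hx.2
    have := closure_mono hsub hm
    simpa using this
  filter_upwards [LocallyIntegrable.ae_hasDerivAt_integral hL] with x hx
  have h1 := hx 0
  have h2 : HasDerivAt g 0 x := by
    rw [show g = fun _ => 0 from funext hg0]
    exact hasDerivAt_const _ _
  exact sub_eq_zero.1 (h1.unique h2)
/-- If `F` is holomorphic in a neighborhood of `(𝕋+1) ∪ {0}`
(the spectrum of the Cesàro operator `C` on `L²(ℝ)` together with `0`) and `F 0 = 0`,
then `F(C)` (holomorphic functional calculus, realized for the normal operator `C`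
as `cfc F C`) is the Hausdorff operator `ℋ_K` for a unique kernel `K`, and `K`
satisfies (a) `K = 0` a.e. on `(-∞,0)`, (b) `K(u) u^{-1/2} ∈ L¹(0,∞)`, and
(c) `(ℳK)(z) = F(1/z)` on the line `Re z = 1/2`. -/
theorem stmt0
    (C : L2 →L[ℂ] L2) (hC : IsCesaroOp C) (hN : IsStarNormal C)
    (hσ : spectrum ℂ C = Metric.sphere (1:ℂ) 1)
    (F : ℂ → ℂ) (U : Set ℂ) (hU : IsOpen U)
    (hsub : Metric.sphere (1:ℂ) 1 ∪ {0} ⊆ U)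
    (hF : DifferentiableOn ℂ F U) (hF0 : F 0 = 0) :
    ∃ K : ℝ → ℂ, Measurable K ∧
      IsHausdorffOp K (cfc F C) ∧
      (∀ᵐ u : ℝ ∂MeasureTheory.volume, u < 0 → K u = 0) ∧
      MeasureTheory.IntegrableOn (fun u : ℝ => ‖K u‖ * u ^ (-(1/2) : ℝ)) (Set.Ioi 0) ∧
      (∀ z : ℂ, z.re = 1/2 → mellin K z = F z⁻¹) ∧
      (∀ K' : ℝ → ℂ, Measurable K' → HausdorffKernelCond K' →
        IsHausdorffOp K' (cfc F C) → K' =ᵐ[MeasureTheory.volume] K) := by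
  have hS : Metric.sphere (1:ℂ) 1 ⊆ U := fun w hw => hsub (Or.inl hw)
  obtain ⟨r, R, hr0, hr, hR, hann⟩ := exists_annulus U hU hS
  have hFR : ContinuousOn F (Metric.sphere (1:ℂ) R) := by
    refine hF.continuousOn.mono fun w hw => hann ?_
    rw [Metric.mem_sphere] at hw
    exact ⟨by simp only [Metric.mem_closedBall]; linarith, by simp only [Metric.mem_ball]; linarith⟩
  have hFr : ContinuousOn F (Metric.sphere (1:ℂ) r) := by
    refine hF.continuousOn.mono fun w hw => hann ?_
    rw [Metric.mem_sphere] at hw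
    exact ⟨by simp only [Metric.mem_closedBall]; linarith, by simp only [Metric.mem_ball]; linarith⟩
  have hR0 : 0 < R := by linarith
  have hpi : (2 * Real.pi * I : ℂ) ≠ 0 := by
    simp [Real.pi_ne_zero]
  have hcau := cauchy_annulus F U hU hF r R hr0 hr hR hann
  have hc0 := hcau 0 zero_mem_sphere
  rw [hF0, mul_zero] at hc0
  set h : L1P := (2 * Real.pi * I : ℂ)⁻¹ • (GKer F R - GKer F r) with hh
  have hcfc : cfc F C = TOp h := by
    have e1 : cfc F C = cfc (fun w => (2 * Real.pi * I : ℂ)⁻¹ *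
        ((∮ ζ in C(1, R), (ζ - w)⁻¹ * F ζ) - (∮ ζ in C(1, r), (ζ - w)⁻¹ * F ζ))) C := by
      refine cfc_congr fun w hw => ?_
      rw [hσ] at hw
      rw [hcau w hw, inv_mul_cancel_left₀ hpi]
    have cR := cont_circ_int F R hR0 hR.ne' hFR
    have cr := cont_circ_int F r hr0 hr.ne hFr
    rw [← hσ] at cR cr
    rw [e1, cfc_const_mul _ (fun w => (∮ ζ in C(1, R), (ζ - w)⁻¹ * F ζ) -
      (∮ ζ in C(1, r), (ζ - w)⁻¹ * F ζ)) C (cR.sub cr), cfc_sub _ _ C cR cr,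
      cfc_circle C hC hN hσ F R hR0 hR.ne' hFR, cfc_circle C hC hN hσ F r hr0 hr.ne hFr,
      add_sub_add_comm, ← sub_smul, hc0, zero_smul, zero_add, hh, map_smul, map_sub]
  have hmel : ∀ z (hz : z.re = 1/2), mel z hz h = F z⁻¹ := by
    intro z hz
    rw [hh, map_smul, map_sub, GKer_mel F R hR0 hR.ne' hFR, GKer_mel F r hr0 hr.ne hFr,
      sub_sub_sub_comm, hc0, sub_zero, hcau _ (inv_mem_sphere z hz), smul_eq_mul,
      inv_mul_cancel_left₀ hpi]
  clear_value h
  set K : ℝ → ℂ := (Set.Ioi (0:ℝ)).indicator (fun u => h u * ((u ^ (1/2:ℝ) : ℝ) : ℂ)) with hKd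
  have hKp : ∀ u : ℝ, 0 < u → K u = h u * ((u ^ (1/2:ℝ) : ℝ) : ℂ) := fun u hu =>
    Set.indicator_of_mem (Set.mem_Ioi.2 hu) _
  have hKn : ∀ u : ℝ, u ≤ 0 → K u = 0 := fun u hu =>
    Set.indicator_of_notMem (by simpa using hu) _
  have hKm : Measurable K := by
    refine Measurable.indicator (h.meas.mul ?_) measurableSet_Ioi
    fun_prop
  have hnorm : ∀ u : ℝ, 0 < u → ‖K u‖ * u ^ (-(1/2) : ℝ) = ‖h u‖ := by
    intro u hu
    rw [hKp u hu, norm_mul, Complex.norm_real, Real.norm_of_nonneg (by positivity), mul_assoc,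
      ← Real.rpow_add hu]
    norm_num
  have hKH : IsHausdorffOp K (cfc F C) := by
    intro f
    rw [hcfc]
    filter_upwards [TOp_coe h f] with x hx
    rw [hx, tfun, ← integral_indicator measurableSet_Ioi]
    refine integral_congr_ae (Eventually.of_forall fun u => ?_)
    beta_reduce
    by_cases hu : 0 < u
    · rw [Set.indicator_of_mem (Set.mem_Ioi.2 hu), hKp u hu, mul_assoc]
    · rw [Set.indicator_of_notMem (by simpa using hu), hKn u (not_lt.1 hu), zero_mul]
  have hKb : IntegrableOn (fun u : ℝ => ‖K u‖ * u ^ (-(1/2) : ℝ)) (Set.Ioi 0) := by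
    refine (integrable_congr ?_).2 h.int.norm
    filter_upwards [ae_restrict_mem measurableSet_Ioi] with u hu
    exact hnorm u hu
  have hKc : HausdorffKernelCond K := by
    have h1 := (integrable_indicator_iff measurableSet_Ioi).2 hKb
    refine (integrable_congr (Eventually.of_forall fun u => ?_)).2 h1
    beta_reduce
    by_cases hu : 0 < u
    · rw [Set.indicator_of_mem (Set.mem_Ioi.2 hu), abs_of_pos hu]
    · rw [Set.indicator_of_notMem (by simpa using hu), hKn u (not_lt.1 hu), norm_zero, zero_mul]
  refine ⟨K, hKm, hKH, Eventually.of_forall fun u hu => hKn u hu.le, hKb, ?_, ?_⟩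
  · intro z hz
    rw [← hmel z hz, mel_apply, mellin]
    refine setIntegral_congr_fun measurableSet_Ioi fun u hu => ?_
    have hu' : (u : ℂ) ≠ 0 := by exact_mod_cast (ne_of_gt hu)
    beta_reduce
    rw [hKp u hu, smul_eq_mul, Complex.ofReal_cpow (le_of_lt hu), mul_left_comm,
      ← Complex.cpow_add _ _ hu']
    congr 2
    push_cast
    ring
  · intro K' hm' hc' hH'
    exact haus_unique K K' hKm hm' hKc hc' _ hKH hH'
end
end

section
/- Let K be a measurable function on ℝ satisfying: (a) K(u) = 0 for a.e. u < 0; (b) K(u)·u^{−1/2} ∈ L¹(0,∞); (c) (ℳK)(z) = F(1/z) for all z on the line Re z = 1/2, where F is a function holomorphic in some neighborhood of the circle 𝕋+1 = {z ∈ ℂ : |z−1| = 1}. Then F(0) = 0 and the Hausdorff operator ℋ_K on L²(ℝ) equals F(𝒞), where 𝒞 is the continuous Cesàro operator on L²(ℝ). -/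
open MeasureTheory Complex Filter

noncomputable section

/-- Existence of the dilation operators. -/
lemma exists_dil (a : ℝ) (ha : 0 < a) : ∃ D : L2 →L[ℂ] L2,
    (∀ f : L2, ∀ᵐ x : ℝ, D f x = f (a * x)) ∧ ‖D‖ ≤ a ^ (-(1/2) : ℝ) := by
  have hmap := Real.map_volume_mul_left ha.ne'
  have hm : Measurable (fun x : ℝ => a * x) := by fun_prop
  have hc0 : ENNReal.ofReal |a⁻¹| ≠ 0 := by simp [ha.ne']
  have hq : Measure.QuasiMeasurePreserving (fun x : ℝ => a * x) volume volume := by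
    refine ⟨hm, ?_⟩
    rw [hmap]
    exact Measure.smul_absolutelyContinuous
  have hn : ∀ f : L2, eLpNorm (fun x => f (a * x)) 2 volume
      = ENNReal.ofReal (a ^ (-(1/2) : ℝ)) * eLpNorm f 2 volume := by
    intro f
    have h1 := eLpNorm_map_measure (p := 2) (f := fun x : ℝ => a * x) (μ := volume)
      (g := f) (Lp.stronglyMeasurable f).aestronglyMeasurable hm.aemeasurable
    have h2 : eLpNorm (fun x => f (a * x)) 2 volume = eLpNorm (f ∘ fun x => a * x) 2 volume := rfl
    rw [h2, ← h1, hmap, eLpNorm_smul_measure_of_ne_zero hc0, smul_eq_mul]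
    congr 1
    rw [ENNReal.ofReal_rpow_of_pos (by positivity), abs_of_pos (by positivity),
      Real.inv_rpow ha.le, ← Real.rpow_neg ha.le]
    norm_num
  have hmem : ∀ f : L2, MemLp (fun x => f (a * x)) 2 volume := by
    intro f
    refine ⟨((Lp.stronglyMeasurable f).comp_measurable hm).aestronglyMeasurable, ?_⟩
    rw [hn]
    exact ENNReal.mul_lt_top ENNReal.ofReal_lt_top (Lp.eLpNorm_lt_top f)
  let D0 : L2 →ₗ[ℂ] L2 :=
    { toFun := fun f => (hmem f).toLp _
      map_add' := by
        intro f g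
        rw [← MemLp.toLp_add]
        apply MemLp.toLp_congr
        exact hq.ae (Lp.coeFn_add f g)
      map_smul' := by
        intro c f
        rw [RingHom.id_apply, ← MemLp.toLp_const_smul]
        apply MemLp.toLp_congr
        exact hq.ae (Lp.coeFn_smul c f) }
  refine ⟨D0.mkContinuous (a ^ (-(1/2) : ℝ)) ?_, ?_, ?_⟩
  · intro f
    change ‖(hmem f).toLp _‖ ≤ _
    rw [Lp.norm_toLp, hn, ENNReal.toReal_mul, ENNReal.toReal_ofReal (by positivity), Lp.norm_def]
  · intro f
    exact (hmem f).coeFn_toLp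
  · exact LinearMap.mkContinuous_norm_le _ (by positivity) _

open Classical in
/-- The dilation operator `f ↦ f(a ·)`, for `a > 0`. -/
def dil (a : ℝ) : L2 →L[ℂ] L2 := if h : 0 < a then (exists_dil a h).choose else 0

lemma dil_ae {a : ℝ} (ha : 0 < a) (f : L2) : ∀ᵐ x : ℝ, dil a f x = f (a * x) := by
  rw [dil, dif_pos ha]; exact (exists_dil a ha).choose_spec.1 f

lemma dil_norm {a : ℝ} (ha : 0 < a) : ‖dil a‖ ≤ a ^ (-(1/2) : ℝ) := by
  rw [dil, dif_pos ha]; exact (exists_dil a ha).choose_spec.2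

lemma quasi_mul {a : ℝ} (ha : a ≠ 0) :
    Measure.QuasiMeasurePreserving (fun x : ℝ => a * x) volume volume := by
  refine ⟨by fun_prop, ?_⟩
  rw [Real.map_volume_mul_left ha]
  exact Measure.smul_absolutelyContinuous

lemma dil_comp {a b : ℝ} (ha : 0 < a) (hb : 0 < b) (f : L2) : dil a (dil b f) = dil (a * b) f := by
  apply Lp.ext
  filter_upwards [dil_ae ha (dil b f), dil_ae (mul_pos ha hb) f,
    (quasi_mul ha.ne').ae (dil_ae hb f)] with x h1 h2 h3
  rw [h1, h2, h3]
  congr 1; ring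

lemma dil_one : dil 1 = ContinuousLinearMap.id ℂ L2 := by
  ext1 f
  apply Lp.ext
  filter_upwards [dil_ae one_pos f] with x h1
  simp [h1]

/-- Integrability condition on kernels. -/
def KerInt (K : ℝ → ℂ) : Prop :=
  IntegrableOn (fun u : ℝ => ‖K u‖ * u ^ (-(1/2) : ℝ)) (Set.Ioi 0)

lemma norm_int_le (g h : L2) : ∫ x, ‖g x‖ * ‖h x‖ ≤ ‖g‖ * ‖h‖ := by
  have h1 : eLpNorm ((fun x => ‖g x‖) • (fun x => ‖h x‖)) 1 volume
      ≤ eLpNorm (fun x => ‖g x‖) 2 volume * eLpNorm (fun x => ‖h x‖) 2 volume :=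
    eLpNorm_smul_le_mul_eLpNorm (Lp.stronglyMeasurable h).norm.aestronglyMeasurable
      (Lp.stronglyMeasurable g).norm.aestronglyMeasurable
  rw [eLpNorm_norm, eLpNorm_norm] at h1
  have h2 : ∫ x, ‖g x‖ * ‖h x‖
      = (eLpNorm ((fun x => ‖g x‖) • (fun x => ‖h x‖)) 1 volume).toReal := by
    rw [eLpNorm_one_eq_lintegral_enorm, ← integral_norm_eq_lintegral_enorm]
    · congr 1; ext x; simp
    · exact ((Lp.stronglyMeasurable g).norm.smul
        (Lp.stronglyMeasurable h).norm).aestronglyMeasurable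
  rw [h2, Lp.norm_def, Lp.norm_def, ← ENNReal.toReal_mul]
  exact ENNReal.toReal_mono (ENNReal.mul_ne_top (Lp.eLpNorm_ne_top g) (Lp.eLpNorm_ne_top h)) h1

lemma fubini_int {K : ℝ → ℂ} (hm : Measurable K) (hK : KerInt K) (g f : L2) :
    Integrable (Function.uncurry fun x u : ℝ => inner ℂ (g x) (K u * f (u * x)))
      (volume.prod (volume.restrict (Set.Ioi 0))) := by
  have hg := (Lp.stronglyMeasurable g).measurable
  have hf := (Lp.stronglyMeasurable f).measurable
  have hmeas : Measurable (Function.uncurry fun x u : ℝ => inner ℂ (g x) (K u * f (u * x))) := by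
    unfold Function.uncurry
    apply Measurable.inner
    · fun_prop
    · have : Measurable (fun p : ℝ × ℝ => f (p.2 * p.1)) := hf.comp (by fun_prop)
      exact (hm.comp measurable_snd).mul this
  rw [integrable_prod_iff' hmeas.aestronglyMeasurable]
  have key : ∀ u > 0, (fun x => inner ℂ (g x) (K u * f (u * x)))
      =ᵐ[volume] fun x => K u * inner ℂ (g x) (dil u f x) := by
    intro u hu
    filter_upwards [dil_ae hu f] with x hx
    rw [hx]; simp only [RCLike.inner_apply]; ring
  constructor
  · filter_upwards [ae_restrict_mem measurableSet_Ioi] with u hu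
    exact ((L2.integrable_inner g (dil u f)).const_mul (K u)).congr (key u hu).symm
  · refine Integrable.mono' (hK.const_mul (‖g‖ * ‖f‖)) ?_ ?_
    · exact (hmeas.norm.stronglyMeasurable.integral_prod_left').aestronglyMeasurable
    · filter_upwards [ae_restrict_mem measurableSet_Ioi] with u hu
      have hu : 0 < u := hu
      rw [Real.norm_of_nonneg (integral_nonneg fun _ => norm_nonneg _)]
      have : ∫ x, ‖Function.uncurry (fun x u : ℝ => inner ℂ (g x) (K u * f (u * x))) (x, u)‖
          = ‖K u‖ * ∫ x, ‖g x‖ * ‖dil u f x‖ := by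
        rw [← integral_const_mul]
        apply integral_congr_ae
        filter_upwards [dil_ae hu f] with x hx
        simp only [Function.uncurry, RCLike.inner_apply, hx, norm_mul, RCLike.norm_conj]
        ring
      rw [this]
      calc ‖K u‖ * ∫ x, ‖g x‖ * ‖dil u f x‖ ≤ ‖K u‖ * (‖g‖ * (u ^ (-(1/2) : ℝ) * ‖f‖)) := by
            gcongr
            refine (norm_int_le _ _).trans ?_
            gcongr
            exact (dil u).le_of_opNorm_le (dil_norm hu) f
        _ = _ := by ring

lemma inner_dil {K : ℝ → ℂ} (u : ℝ) (hu : 0 < u) (g f : L2) :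
    ∫ x, inner ℂ (g x) (K u * f (u * x)) = K u * inner ℂ g (dil u f) := by
  rw [L2.inner_def, ← integral_const_mul]
  apply integral_congr_ae
  filter_upwards [dil_ae hu f] with x hx
  rw [hx]; simp only [RCLike.inner_apply]; ring

lemma pair_integrable {K : ℝ → ℂ} (hm : Measurable K) (hK : KerInt K) (g f : L2) :
    IntegrableOn (fun u => K u * inner ℂ g (dil u f)) (Set.Ioi 0) := by
  refine (fubini_int hm hK g f).integral_prod_right.congr ?_
  filter_upwards [ae_restrict_mem measurableSet_Ioi] with u hu
  exact inner_dil u hu g f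

lemma pair_eq {K : ℝ → ℂ} (hm : Measurable K) (hK : KerInt K) (g f : L2) :
    ∫ x, inner ℂ (g x) (∫ u in Set.Ioi 0, K u * f (u * x))
      = ∫ u in Set.Ioi 0, K u * inner ℂ g (dil u f) := by
  have h1 := integral_integral_swap (fubini_int hm hK g f)
  have h2 : ∫ u in Set.Ioi 0, ∫ x, inner ℂ (g x) (K u * f (u * x))
      = ∫ u in Set.Ioi 0, K u * inner ℂ g (dil u f) := by
    apply setIntegral_congr_fun measurableSet_Ioi
    intro u hu
    exact inner_dil u hu g f
  rw [← h2, ← h1]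
  congr 1; ext x
  simp only [RCLike.inner_apply]
  rw [← integral_mul_const]

lemma kerInt_ind (b : ℝ) : KerInt (Set.indicator (Set.Ioc 0 b) 1) := by
  have h1 : IntegrableOn (fun u : ℝ => u ^ (-(1/2) : ℝ)) (Set.Ioc 0 b) := by
    by_cases hb : 0 ≤ b
    · have := intervalIntegral.intervalIntegrable_rpow' (a := 0) (b := b) (r := -(1/2)) (by norm_num)
      rwa [intervalIntegrable_iff_integrableOn_Ioc_of_le hb] at this
    · rw [Set.Ioc_eq_empty (by linarith)]; exact integrableOn_empty
  have h2 := (integrable_indicator_iff measurableSet_Ioc).2 h1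
  refine (h2.congr (Eventually.of_forall fun u => ?_)).integrableOn
  by_cases hu : u ∈ Set.Ioc 0 b <;> simp [hu]

lemma meas_ind (b : ℝ) : Measurable (Set.indicator (Set.Ioc 0 b) (1 : ℝ → ℂ)) :=
  measurable_one.indicator measurableSet_Ioc

lemma dil_intervalIntegrable (g f : L2) {b : ℝ} (hb : 0 ≤ b) :
    IntervalIntegrable (fun u => inner ℂ g (dil u f)) volume 0 b := by
  rw [intervalIntegrable_iff_integrableOn_Ioc_of_le hb]
  have h1 := (pair_integrable (meas_ind b) (kerInt_ind b) g f).mono_set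
    (Set.Ioc_subset_Ioi_self : Set.Ioc 0 b ⊆ _)
  refine h1.congr_fun ?_ measurableSet_Ioc
  intro u hu
  simp [hu]

lemma inner_C {C : L2 →L[ℂ] L2} (hC : IsCesaroOp C) (g f : L2) :
    inner ℂ g (C f) = ∫ u in (0:ℝ)..1, inner ℂ g (dil u f) := by
  have e : ∀ φ : ℝ → ℂ, ∫ u in Set.Ioi 0, (Set.Ioc (0:ℝ) 1).indicator (1 : ℝ → ℂ) u * φ u
      = ∫ u in Set.Ioc 0 1, φ u := by
    intro φ
    have : (fun u => (Set.Ioc (0:ℝ) 1).indicator (1 : ℝ → ℂ) u * φ u)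
      = (Set.Ioc (0:ℝ) 1).indicator φ := by
      ext u; by_cases hu : u ∈ Set.Ioc (0:ℝ) 1 <;> simp [hu]
    rw [this, setIntegral_indicator measurableSet_Ioc]
    congr 2
    exact Set.inter_eq_right.2 Set.Ioc_subset_Ioi_self
  have h := pair_eq (meas_ind 1) (kerInt_ind 1) g f
  rw [e] at h
  rw [intervalIntegral.integral_of_le zero_le_one, ← h, L2.inner_def]
  apply integral_congr_ae
  filter_upwards [hC f] with x hx
  rw [hx, e, integral_Ioc_eq_integral_Ioo]

/-- `S a = a C D_a`. -/
def Sop (C : L2 →L[ℂ] L2) (a : ℝ) : L2 →L[ℂ] L2 := a • (C * dil a)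

lemma inner_S {C : L2 →L[ℂ] L2} (hC : IsCesaroOp C) (g f : L2) {a : ℝ} (ha : 0 < a) :
    inner ℂ g (Sop C a f) = ∫ v in (0:ℝ)..a, inner ℂ g (dil v f) := by
  have h1 : inner ℂ g (Sop C a f) = a • inner ℂ g (C (dil a f)) := by
    simp only [Sop, smul_apply, mul_apply_eq_comp]
    rw [inner_smul_right_eq_smul]
  rw [h1, inner_C hC]
  have h2 : ∫ u in (0:ℝ)..1, inner ℂ g (dil u (dil a f))
      = ∫ u in (0:ℝ)..1, inner ℂ g (dil (u * a) f) := by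
    apply intervalIntegral.integral_congr_ae
    refine Eventually.of_forall fun u hu => ?_
    rw [Set.uIoc_of_le zero_le_one] at hu
    rw [dil_comp hu.1 ha]
  rw [h2]
  have := intervalIntegral.smul_integral_comp_mul_right (a := 0) (b := 1)
    (fun v => inner ℂ g (dil v f)) a
  rw [this]; simp

lemma inner_S_sub {C : L2 →L[ℂ] L2} (hC : IsCesaroOp C) (g f : L2) {a b : ℝ} (ha : 0 < a)
    (hb : 0 < b) :
    inner ℂ g ((Sop C b - Sop C a) f) = ∫ v in a..b, inner ℂ g (dil v f) := by
  rw [sub_apply, inner_sub_right, inner_S hC g f ha, inner_S hC g f hb,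
    intervalIntegral.integral_interval_sub_left (dil_intervalIntegrable g f hb.le)
      (dil_intervalIntegrable g f ha.le)]

lemma S_lip {C : L2 →L[ℂ] L2} (hC : IsCesaroOp C) {a b c : ℝ} (hc : 0 < c) (ha : c ≤ a)
    (hb : c ≤ b) : ‖Sop C b - Sop C a‖ ≤ c ^ (-(1/2) : ℝ) * |b - a| := by
  refine ContinuousLinearMap.opNorm_le_bound _ (by positivity) fun f => ?_
  set y := (Sop C b - Sop C a) f with hy
  have h1 : ‖inner ℂ y y‖ ≤ (c ^ (-(1/2) : ℝ) * ‖f‖ * ‖y‖) * |b - a| := by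
    conv_lhs => rw [hy]
    rw [inner_S_sub hC _ f (hc.trans_le ha) (hc.trans_le hb), ← hy]
    apply intervalIntegral.norm_integral_le_of_norm_le_const
    intro v hv
    have hv' : c ≤ v := (le_min ha hb).trans hv.1.le
    have hv0 : 0 < v := hc.trans_le hv'
    calc ‖inner ℂ y (dil v f)‖ ≤ ‖y‖ * ‖dil v f‖ := norm_inner_le_norm _ _
      _ ≤ ‖y‖ * (v ^ (-(1/2) : ℝ) * ‖f‖) := by
          gcongr; exact (dil v).le_of_opNorm_le (dil_norm hv0) f
      _ ≤ ‖y‖ * (c ^ (-(1/2) : ℝ) * ‖f‖) := by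
          gcongr ‖y‖ * (?_ * _)
          exact Real.rpow_le_rpow_of_nonpos hc hv' (by norm_num)
      _ = _ := by ring
  rw [inner_self_eq_norm_sq_to_K] at h1
  simp only [norm_pow, RCLike.norm_ofReal, abs_norm] at h1
  by_cases hy0 : ‖y‖ = 0
  · rw [hy0]; positivity
  · have : 0 < ‖y‖ := lt_of_le_of_ne (norm_nonneg _) (Ne.symm hy0)
    refine le_of_mul_le_mul_right ?_ this
    nlinarith

lemma S_cont {C : L2 →L[ℂ] L2} (hC : IsCesaroOp C) : ContinuousOn (Sop C) (Set.Ioi 0) := by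
  intro a ha
  have ha : 0 < a := ha
  apply ContinuousAt.continuousWithinAt
  rw [ContinuousAt, tendsto_iff_norm_sub_tendsto_zero]
  have h2 : Tendsto (fun b : ℝ => (a/2) ^ (-(1/2) : ℝ) * |b - a|) (nhds a) (nhds 0) := by
    have : Continuous (fun b : ℝ => (a/2) ^ (-(1/2) : ℝ) * |b - a|) := by fun_prop
    simpa using this.tendsto a
  refine squeeze_zero' (Eventually.of_forall fun _ => norm_nonneg _) ?_ h2
  filter_upwards [lt_mem_nhds (show a/2 < a by linarith)] with b hb
  exact S_lip hC (half_pos ha) (by linarith) hb.le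

lemma inv_smul_cont {E : Type*} [NormedAddCommGroup E] [NormedSpace ℝ E]
    {S : ℝ → E} (hS : ContinuousOn S (Set.Ioi 0)) :
    ContinuousOn (fun v : ℝ => v⁻¹ • S v) (Set.Ioi 0) :=
  (continuousOn_inv₀.mono fun _ hv => ne_of_gt (Set.mem_Ioi.1 hv)).smul hS

lemma CS_sub {C : L2 →L[ℂ] L2} (hC : IsCesaroOp C) {a b : ℝ} (ha : 0 < a) (hb : a ≤ b) :
    C * Sop C b - C * Sop C a = ∫ v in a..b, v⁻¹ • Sop C v := by
  have hcont : ContinuousOn (fun v : ℝ => v⁻¹ • Sop C v) (Set.uIcc a b) := by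
    rw [Set.uIcc_of_le hb]
    exact (inv_smul_cont (S_cont hC)).mono fun v hv => ha.trans_le hv.1
  have hb0 := ha.trans_le hb
  ext1 f
  refine ext_inner_left ℂ fun g => ?_
  let L : (L2 →L[ℂ] L2) →L[ℂ] ℂ := (innerSL ℂ g) ∘L (ContinuousLinearMap.apply ℂ L2 f)
  have hL : ∀ T, L T = inner ℂ g (T f) := fun T => rfl
  rw [← hL (∫ v in a..b, v⁻¹ • Sop C v),
    ← ContinuousLinearMap.intervalIntegral_comp_comm L hcont.intervalIntegrable]
  rw [← mul_sub, mul_apply_eq_comp, ← ContinuousLinearMap.adjoint_inner_left,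
    inner_S_sub hC _ f ha hb0]
  apply intervalIntegral.integral_congr
  intro v hv
  rw [Set.uIcc_of_le hb] at hv
  have hv0 : v ≠ 0 := (ha.trans_le hv.1).ne'
  simp only [hL, Sop]
  rw [ContinuousLinearMap.adjoint_inner_left, smul_smul, inv_mul_cancel₀ hv0, one_smul]
  rfl

lemma hasDeriv_of_sub {E : Type*} [NormedAddCommGroup E] [NormedSpace ℝ E] [CompleteSpace E]
    {P Φ : ℝ → E} (hΦ : ContinuousOn Φ (Set.Ioi 0))
    (h : ∀ a b : ℝ, 0 < a → a ≤ b → P b - P a = ∫ v in a..b, Φ v) {a : ℝ} (ha : 0 < a) :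
    HasDerivAt P (Φ a) a := by
  have h1 : HasDerivAt (fun b => P (a/2) + ∫ v in (a/2)..b, Φ v) (Φ a) a := by
    refine HasDerivAt.const_add _ ?_
    apply intervalIntegral.integral_hasDerivAt_right
    · apply ContinuousOn.intervalIntegrable
      apply hΦ.mono
      rw [Set.uIcc_of_le (by linarith)]
      intro v hv; exact lt_of_lt_of_le (half_pos ha) hv.1
    · exact hΦ.stronglyMeasurableAtFilter isOpen_Ioi a ha
    · exact hΦ.continuousAt (Ioi_mem_nhds ha)
  refine h1.congr_of_eventuallyEq ?_
  filter_upwards [lt_mem_nhds (show a/2 < a by linarith)] with b hb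
  rw [← h (a/2) b (half_pos ha) hb.le]; abel

lemma CS_deriv {C : L2 →L[ℂ] L2} (hC : IsCesaroOp C) {a : ℝ} (ha : 0 < a) :
    HasDerivAt (fun a => C * Sop C a) (a⁻¹ • Sop C a) a :=
  hasDeriv_of_sub (P := fun a => C * Sop C a) (Φ := fun v => v⁻¹ • Sop C v)
    (inv_smul_cont (S_cont hC)) (fun _ _ h1 h2 => CS_sub hC h1 h2) ha

lemma C_inj {C : L2 →L[ℂ] L2} (hC : IsCesaroOp C) (f : L2) (hf : C f = 0) : f = 0 := by
  have hloc : LocallyIntegrable f volume :=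
    (Lp.memLp f).locallyIntegrable (by norm_num)
  have hintg : ∀ a b, IntervalIntegrable f volume a b := fun a b =>
    (hloc.integrableOn_isCompact isCompact_uIcc).intervalIntegrable
  have hcont : Continuous fun x : ℝ => ∫ t in (0:ℝ)..x, f t :=
    intervalIntegral.continuous_primitive hintg 0
  have h0 : (fun x : ℝ => ∫ t in (0:ℝ)..x, f t) = fun _ => 0 := by
    refine MeasureTheory.Measure.eq_of_ae_eq (μ := volume) ?_ hcont continuous_const
    have h1 := hC f
    rw [hf] at h1
    filter_upwards [h1, Lp.coeFn_zero ℂ 2 (volume : Measure ℝ)] with x hx hx0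
    rw [hx0, ← integral_Ioc_eq_integral_Ioo, ← intervalIntegral.integral_of_le zero_le_one] at hx
    have := intervalIntegral.smul_integral_comp_mul_right (a := 0) (b := 1) (fun v => f v) x
    rw [← hx] at this
    simpa using this.symm
  apply Lp.ext
  filter_upwards [_root_.LocallyIntegrable.ae_hasDerivAt_integral hloc, Lp.coeFn_zero ℂ 2 (volume : Measure ℝ)] with x hx hx0
  have := hx 0
  rw [h0] at this
  rw [hx0]
  exact this.unique (hasDerivAt_const x (0:ℂ))

/-- Symbol of `a C D_a`. -/
def rfun (a : ℝ) (w : ℂ) : ℂ := w * Complex.exp (Real.log a * w⁻¹)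

lemma sphere_re {w : ℂ} (hw : w ∈ Metric.sphere (1:ℂ) 1) (h0 : w ≠ 0) : (w⁻¹).re = 1/2 := by
  have h1 : ‖w - 1‖ = 1 := by simpa [dist_eq_norm] using hw
  have h2 : Complex.normSq (w - 1) = 1 := by rw [Complex.normSq_eq_norm_sq, h1]; norm_num
  have h3 : Complex.normSq w ≠ 0 := by simpa using h0
  rw [Complex.inv_re, div_eq_iff h3]
  simp only [Complex.normSq_apply, Complex.sub_re, Complex.sub_im, Complex.one_re,
    Complex.one_im] at h2 ⊢
  linarith

lemma sphere_norm {w : ℂ} (hw : w ∈ Metric.sphere (1:ℂ) 1) : ‖w‖ ≤ 2 := by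
  have h1 : ‖w - 1‖ = 1 := by simpa [dist_eq_norm] using hw
  calc ‖w‖ = ‖(w - 1) + 1‖ := by ring_nf
    _ ≤ ‖w - 1‖ + ‖(1:ℂ)‖ := norm_add_le _ _
    _ = 2 := by rw [h1]; norm_num

lemma rfun_norm {w : ℂ} (hw : w ∈ Metric.sphere (1:ℂ) 1) {a : ℝ} (ha : 0 < a) :
    ‖rfun a w‖ = ‖w‖ * a ^ (1/2 : ℝ) := by
  by_cases h0 : w = 0
  · simp [rfun, h0]
  · rw [rfun, norm_mul, Complex.norm_exp, Complex.re_ofReal_mul, sphere_re hw h0,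
      Real.rpow_def_of_pos ha]

lemma rfun_cont : ContinuousOn (Function.uncurry rfun) (Set.Ioi 0 ×ˢ Metric.sphere (1:ℂ) 1) := by
  rintro ⟨a, w⟩ ⟨ha, hw⟩
  have ha : 0 < a := ha
  by_cases h0 : w = 0
  · subst h0
    have hz : Function.uncurry rfun (a, 0) = 0 := by simp [Function.uncurry, rfun]
    rw [ContinuousWithinAt, hz]
    apply squeeze_zero_norm' (a := fun p : ℝ × ℂ => ‖p.2‖ * p.1 ^ (1/2 : ℝ))
    · filter_upwards [self_mem_nhdsWithin] with p hp
      exact (rfun_norm hp.2 hp.1).le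
    · have : ContinuousAt (fun p : ℝ × ℂ => ‖p.2‖ * p.1 ^ (1/2 : ℝ)) (a, 0) := by
        apply ContinuousAt.mul (by fun_prop)
        exact ContinuousAt.rpow_const continuousAt_fst (Or.inl ha.ne')
      have h2 := this.tendsto.mono_left (nhdsWithin_le_nhds (s := Set.Ioi 0 ×ˢ Metric.sphere (1:ℂ) 1))
      simpa using h2
  · apply ContinuousAt.continuousWithinAt
    have h1 : ContinuousAt (fun p : ℝ × ℂ => ((Real.log p.1 : ℝ) : ℂ)) (a, w) := by
      apply Complex.continuous_ofReal.continuousAt.comp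
      exact ContinuousAt.log continuousAt_fst ha.ne'
    have h2 : ContinuousAt (fun p : ℝ × ℂ => p.2⁻¹) (a, w) := continuousAt_snd.inv₀ h0
    exact continuousAt_snd.mul (h1.mul h2).cexp

lemma rfun_contOn {a : ℝ} (ha : 0 < a) : ContinuousOn (rfun a) (Metric.sphere (1:ℂ) 1) :=
  rfun_cont.comp (f := fun w => (a, w)) (Continuous.prodMk_right a).continuousOn
    fun _ hw => ⟨ha, hw⟩

lemma rfun_deriv (w : ℂ) {a : ℝ} (ha : 0 < a) :
    HasDerivAt (fun a => w * rfun a w) (((a⁻¹ : ℝ) : ℂ) * rfun a w) a := by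
  by_cases h0 : w = 0
  · simpa [rfun, h0] using hasDerivAt_const a (0:ℂ)
  · have h1 : HasDerivAt (fun a : ℝ => ((Real.log a : ℝ) : ℂ)) ((a⁻¹ : ℝ) : ℂ) a :=
      (Real.hasDerivAt_log ha.ne').ofReal_comp
    have h2 := (((h1.mul_const w⁻¹).cexp).const_mul w).const_mul w
    refine h2.congr_deriv ?_
    unfold rfun; push_cast; field_simp

/-- `R a = r_a(C)`. -/
def Rop (C : L2 →L[ℂ] L2) (a : ℝ) : L2 →L[ℂ] L2 := cfc (rfun a) C

lemma R_cont {C : L2 →L[ℂ] L2} (hσ : spectrum ℂ C = Metric.sphere (1:ℂ) 1) : ContinuousOn (Rop C) (Set.Ioi 0) := by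
  intro a ha
  refine continuousWithinAt_cfc_fun (R := ℂ) ?_ ?_
  · rw [hσ]
    intro u hu
    obtain ⟨v, hv, h⟩ := (isCompact_sphere (1:ℂ) 1).mem_uniformity_of_prod rfun_cont ha
      (symm_le_uniformity hu)
    filter_upwards [hv] with b hb w hw
    exact h b hb w hw
  · filter_upwards [self_mem_nhdsWithin] with b hb
    rw [hσ]; exact rfun_contOn hb

lemma R_one {C : L2 →L[ℂ] L2} (hN : IsStarNormal C) : Rop C 1 = C := by
  have : rfun 1 = id := by ext w; simp [rfun]
  rw [Rop, this, cfc_id ℂ C]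

lemma CR_eq {C : L2 →L[ℂ] L2} (hN : IsStarNormal C)
    (hσ : spectrum ℂ C = Metric.sphere (1:ℂ) 1) {a : ℝ} (ha : 0 < a) : C * Rop C a = cfc (fun w => w * rfun a w) C := by
  rw [cfc_mul (fun w => w) (rfun a) C continuousOn_id (by rw [hσ]; exact rfun_contOn ha),
    cfc_id' ℂ C, Rop]

lemma CR_comm {C : L2 →L[ℂ] L2} (hN : IsStarNormal C)
    (hσ : spectrum ℂ C = Metric.sphere (1:ℂ) 1) {a : ℝ} (ha : 0 < a) : C * Rop C a = Rop C a * C := by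
  have h1 := CR_eq hN hσ ha
  have h2 : Rop C a * C = cfc (fun w => rfun a w * w) C := by
    rw [cfc_mul (rfun a) (fun w => w) C (by rw [hσ]; exact rfun_contOn ha) continuousOn_id,
      cfc_id' ℂ C, Rop]
  rw [h1, h2]; simp only [mul_comm]

lemma RR_inv {C : L2 →L[ℂ] L2} (hN : IsStarNormal C)
    (hσ : spectrum ℂ C = Metric.sphere (1:ℂ) 1) {a : ℝ} (ha : 0 < a) : Rop C a * Rop C a⁻¹ = C * C := by
  rw [Rop, Rop, ← cfc_mul (rfun a) (rfun a⁻¹) C (by rw [hσ]; exact rfun_contOn ha)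
    (by rw [hσ]; exact rfun_contOn (inv_pos.2 ha))]
  have : (fun w => rfun a w * rfun a⁻¹ w) = fun w => w * w := by
    ext w
    have : Complex.exp (Real.log a * w⁻¹) * Complex.exp (Real.log a⁻¹ * w⁻¹) = 1 := by
      rw [← Complex.exp_add, Real.log_inv]; simp
    simp only [rfun]
    linear_combination (w * w) * this
  rw [this, cfc_mul (fun w => w) (fun w => w) C, cfc_id' ℂ C]

lemma CR_sub {C : L2 →L[ℂ] L2} (hN : IsStarNormal C)
    (hσ : spectrum ℂ C = Metric.sphere (1:ℂ) 1) {a b : ℝ} (ha : 0 < a) (hb : a ≤ b) :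
    C * Rop C b - C * Rop C a = ∫ v in a..b, v⁻¹ • Rop C v := by
  have hb0 := ha.trans_le hb
  have hsub : Set.Ioc a b ⊆ Set.Ioi 0 := fun v hv => ha.trans hv.1
  have hcw : ∀ v : ℝ, 0 < v → ContinuousOn (fun w => w * rfun v w) (spectrum ℂ C) := by
    intro v hv; rw [hσ]; exact continuousOn_id.mul (rfun_contOn hv)
  have h1 : ∫ v in a..b, v⁻¹ • Rop C v
      = ∫ v in Set.Ioc a b, cfc (fun w => ((v⁻¹ : ℝ) : ℂ) * rfun v w) C := by
    rw [intervalIntegral.integral_of_le hb]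
    apply setIntegral_congr_fun measurableSet_Ioc
    intro v hv
    simp only
    rw [cfc_const_mul _ (rfun v) C (by rw [hσ]; exact rfun_contOn (hsub hv)), Rop]
    exact (algebraMap_smul ℂ v⁻¹ (cfc (rfun v) C)).symm
  have hcv : ContinuousOn (Function.uncurry fun (v : ℝ) (w : ℂ) => ((v⁻¹ : ℝ) : ℂ) * rfun v w)
      (Set.Ioi 0 ×ˢ Metric.sphere (1:ℂ) 1) := by
    refine ContinuousOn.mul ?_ rfun_cont
    apply Complex.continuous_ofReal.comp_continuousOn
    exact continuousOn_fst.inv₀ fun p hp => ne_of_gt hp.1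
  rw [h1, ← cfc_setIntegral (𝕜 := ℂ) measurableSet_Ioc
    (fun (v : ℝ) (w : ℂ) => ((v⁻¹ : ℝ) : ℂ) * rfun v w) (fun _ => a⁻¹ * (2 * b ^ (1/2 : ℝ))) C]
  · rw [CR_eq hN hσ ha, CR_eq hN hσ hb0, ← cfc_sub _ _ C (hcw b hb0) (hcw a ha)]
    apply cfc_congr
    intro w hw
    rw [hσ] at hw
    simp only
    rw [← intervalIntegral.integral_of_le hb]
    symm
    apply intervalIntegral.integral_eq_sub_of_hasDerivAt (f := fun v => w * rfun v w)
    · intro v hv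
      rw [Set.uIcc_of_le hb] at hv
      exact rfun_deriv w (ha.trans_le hv.1)
    · apply ContinuousOn.intervalIntegrable
      have := hcv.comp (f := fun v : ℝ => (v, w)) (s := Set.uIcc a b) (by fun_prop) (by
        intro v hv
        rw [Set.uIcc_of_le hb] at hv
        exact ⟨ha.trans_le hv.1, hw⟩)
      simpa [Function.comp_def, Function.uncurry] using this
  · rw [hσ]
    exact hcv.mono (Set.prod_mono hsub subset_rfl)
  · filter_upwards [ae_restrict_mem measurableSet_Ioc] with v hv w hw
    rw [hσ] at hw
    have hv0 : 0 < v := hsub hv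
    rw [norm_mul, rfun_norm hw hv0, Complex.norm_real, Real.norm_of_nonneg (by positivity)]
    gcongr
    · exact hv.1.le
    · exact sphere_norm hw
    · exact hv.2
  · exact (integrable_const _).hasFiniteIntegral

lemma CR_deriv {C : L2 →L[ℂ] L2} (hN : IsStarNormal C)
    (hσ : spectrum ℂ C = Metric.sphere (1:ℂ) 1) {a : ℝ} (ha : 0 < a) :
    HasDerivAt (fun a => C * Rop C a) (a⁻¹ • Rop C a) a :=
  hasDeriv_of_sub (P := fun a => C * Rop C a) (Φ := fun v => v⁻¹ • Rop C v)
    (inv_smul_cont (R_cont hσ)) (fun _ _ h1 h2 => CR_sub hN hσ h1 h2) ha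

lemma C_cancel {C : L2 →L[ℂ] L2} (hC : IsCesaroOp C) {A B : L2 →L[ℂ] L2} (h : C * A = C * B) : A = B := by
  ext1 f
  have h1 : C ((A - B) f) = 0 := by
    have : (C * (A - B)) f = 0 := by rw [mul_sub, h, sub_self]; rfl
    exact this
  have := C_inj hC _ h1
  rw [sub_apply] at this
  exact sub_eq_zero.1 this

lemma S_eq_R {C : L2 →L[ℂ] L2} (hN : IsStarNormal C)
    (hσ : spectrum ℂ C = Metric.sphere (1:ℂ) 1) (hC : IsCesaroOp C) {a : ℝ} (ha : 0 < a) : Sop C a = Rop C a := by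
  have hQ : ∀ a : ℝ, 0 < a → HasDerivAt (fun a => (C * Rop C a⁻¹) * (C * Sop C a)) 0 a := by
    intro a ha
    have h1 := (CR_deriv hN hσ (inv_pos.2 ha)).scomp a (hasDerivAt_inv ha.ne')
    have h2 := h1.mul (CS_deriv hC ha)
    refine h2.congr_deriv ?_
    have hcoef : -(a ^ 2)⁻¹ * a = -a⁻¹ := by field_simp
    simp only [Function.comp_apply, inv_inv, smul_smul, hcoef]
    rw [CR_comm hN hσ (inv_pos.2 ha), smul_mul_assoc, mul_smul_comm, mul_assoc, neg_smul]
    exact neg_add_cancel _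
  have hS1 : Sop C 1 = C := by
    rw [Sop, dil_one, one_smul]; rfl
  have hconst := isOpen_Ioi.is_const_of_deriv_eq_zero (s := Set.Ioi (0:ℝ)) isPreconnected_Ioi
    (f := fun a => (C * Rop C a⁻¹) * (C * Sop C a))
    (fun a ha => (hQ a ha).differentiableAt.differentiableWithinAt)
    (fun a ha => (hQ a ha).deriv) (x := a) (y := 1) ha (Set.mem_Ioi.2 one_pos)
  simp only [inv_one, R_one hN, hS1] at hconst
  have c1 := CR_comm hN hσ ha
  have c2 := CR_comm hN hσ (inv_pos.2 ha)
  have e1 : Rop C a * ((C * Rop C a⁻¹) * (C * Sop C a)) = C * (C * (C * (C * Sop C a))) := by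
    calc _ = (Rop C a * C) * Rop C a⁻¹ * (C * Sop C a) := by simp only [mul_assoc]
      _ = C * (Rop C a * Rop C a⁻¹) * (C * Sop C a) := by rw [← c1]; simp only [mul_assoc]
      _ = _ := by rw [RR_inv hN hσ ha]; simp only [mul_assoc]
  have e2 : Rop C a * ((C * C) * (C * C)) = C * (C * (C * (C * Rop C a))) := by
    have l : ∀ X, Rop C a * (C * X) = C * (Rop C a * X) := by
      intro X; rw [← mul_assoc, ← c1, mul_assoc]
    simp only [mul_assoc, l, ← c1]
  rw [hconst, e2] at e1
  have cc := fun {A B} => C_cancel hC (A := A) (B := B)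
  exact (cc (cc (cc (cc e1)))).symm


lemma F_zero (K : ℝ → ℂ) (F : ℂ → ℂ) (U : Set ℂ) (hU : IsOpen U)
    (hsub : Metric.sphere (1:ℂ) 1 ⊆ U) (hF : DifferentiableOn ℂ F U)
    (hc : ∀ z : ℂ, z.re = 1/2 → mellin K z = F z⁻¹) : F 0 = 0 := by
  have h0 : (0:ℂ) ∈ U := hsub (by simp)
  have hFc : ContinuousAt F 0 := (hF.differentiableAt (hU.mem_nhds h0)).continuousAt
  set k : ℝ → ℂ := fun u => Real.exp (-(1/2) * u) • K (Real.exp (-u)) with hk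
  have hRL := Real.zero_at_infty_fourier k
  have h1 : Tendsto (fun n : ℕ => (n : ℝ)) atTop (cocompact ℝ) :=
    tendsto_natCast_atTop_atTop.mono_right (by
      rw [cocompact_eq_atBot_atTop]; exact le_sup_right)
  have h2 := hRL.comp h1
  let z : ℕ → ℂ := fun n => ⟨1/2, n * (2 * Real.pi)⟩
  have h3 : ∀ n : ℕ, FourierTransform.fourier k (n : ℝ) = F (z n)⁻¹ := by
    intro n
    rw [← hc (z n) rfl, mellin_eq_fourier]
    simp only [z, hk]
    field_simp
  have hz : Tendsto (fun n => (z n)⁻¹) atTop (nhds 0) := by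
    apply tendsto_inv₀_cobounded.comp
    rw [← tendsto_norm_atTop_iff_cobounded]
    refine tendsto_atTop_mono (f := fun n : ℕ => (n : ℝ)) ?_ tendsto_natCast_atTop_atTop
    intro n
    refine le_trans ?_ (Complex.abs_im_le_norm (z n))
    simp only [z]
    rw [abs_of_nonneg (by positivity)]
    have := Real.pi_gt_three
    nlinarith [(Nat.cast_nonneg n : (0:ℝ) ≤ n)]
  have h4 : Tendsto (fun n => F (z n)⁻¹) atTop (nhds (F 0)) := hFc.tendsto.comp hz
  have h5 : Tendsto (fun n => F (z n)⁻¹) atTop (nhds 0) := by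
    refine h2.congr fun n => ?_
    exact h3 n
  exact tendsto_nhds_unique h4 h5

lemma main_cfc {C : L2 →L[ℂ] L2} (hN : IsStarNormal C)
    (hσ : spectrum ℂ C = Metric.sphere (1:ℂ) 1)
    {K : ℝ → ℂ} (hm : Measurable K) (hK : KerInt K)
    {F : ℂ → ℂ} (hF : ContinuousOn F (Metric.sphere (1:ℂ) 1))
    (hc : ∀ z : ℂ, z.re = 1/2 → mellin K z = F z⁻¹) :
    IntegrableOn (fun u : ℝ => (K u * (u⁻¹ : ℝ)) • Rop C u) (Set.Ioi 0) ∧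
    C * cfc F C = ∫ u in Set.Ioi (0:ℝ), (K u * (u⁻¹ : ℝ)) • Rop C u := by
  have hcpt : CompactSpace (spectrum ℂ C) := by
    rw [hσ]; exact isCompact_iff_compactSpace.1 (isCompact_sphere _ _)
  let φ : ℝ → ℂ → ℂ := fun u w => (K u * (u⁻¹ : ℝ)) * rfun u w
  have hrc : ∀ u : ℝ, 0 < u → ContinuousOn (rfun u) (spectrum ℂ C) := by
    intro u hu; rw [hσ]; exact rfun_contOn hu
  have hcont : ∀ᵐ u ∂(volume.restrict (Set.Ioi (0:ℝ))), ContinuousOn (φ u) (spectrum ℂ C) := by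
    filter_upwards [ae_restrict_mem measurableSet_Ioi] with u hu
    exact continuousOn_const.mul (hrc u hu)
  have hintg : IntegrableOn
      (fun u => ContinuousMap.mkD ((spectrum ℂ C).domRestrict (φ u)) 0) (Set.Ioi 0) := by
    constructor
    · have h1 := ContinuousMap.aeStronglyMeasurable_restrict_mkD_restrict_of_uncurry
        (μ := volume) (s := Set.Ioi (0:ℝ)) (t := spectrum ℂ C) measurableSet_Ioi rfun 0
        (by rw [hσ]; exact rfun_cont)
      have h2 : AEStronglyMeasurable (fun u : ℝ => K u * ((u⁻¹ : ℝ) : ℂ))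
          (volume.restrict (Set.Ioi (0:ℝ))) :=
        (hm.mul (Complex.measurable_ofReal.comp measurable_inv)).aestronglyMeasurable
      refine (h2.smul h1).congr ?_
      filter_upwards [ae_restrict_mem measurableSet_Ioi, hcont] with u hu hcu
      ext w
      simp only [Pi.smul_apply', ContinuousMap.smul_apply]
      rw [ContinuousMap.mkD_apply_of_continuousOn hcu,
        ContinuousMap.mkD_apply_of_continuousOn (hrc u hu)]
      rfl
    · refine ContinuousMap.hasFiniteIntegral_mkD_restrict_of_bound φ _ hcont
        (fun u => 2 * (‖K u‖ * u ^ (-(1/2) : ℝ))) (hK.const_mul 2).hasFiniteIntegral ?_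
      filter_upwards [ae_restrict_mem measurableSet_Ioi] with u hu w hw
      rw [hσ] at hw
      have hu : 0 < u := hu
      have e : u ^ (-(1/2) : ℝ) = u⁻¹ * u ^ (1/2 : ℝ) := by
        rw [← Real.rpow_neg_one, ← Real.rpow_add hu]; norm_num
      simp only [φ]
      rw [norm_mul, norm_mul, rfun_norm hw hu, Complex.norm_real,
        Real.norm_of_nonneg (by positivity), e]
      have := mul_le_mul_of_nonneg_left (sphere_norm hw)
        (show 0 ≤ ‖K u‖ * u⁻¹ * u ^ (1/2 : ℝ) by positivity)
      nlinarith
  have hcfc : ∀ u ∈ Set.Ioi (0:ℝ), cfc (φ u) C = (K u * (u⁻¹ : ℝ)) • Rop C u := by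
    intro u hu
    rw [Rop, ← cfc_const_mul _ (rfun u) C (hrc u hu)]
  refine ⟨?_, ?_⟩
  · have := integrableOn_cfc' (μ := volume) (s := Set.Ioi (0:ℝ)) φ C hintg
    exact this.congr_fun hcfc measurableSet_Ioi
  · rw [← setIntegral_congr_fun measurableSet_Ioi hcfc, ← cfc_setIntegral' φ C hcont hintg]
    have h1 : C * cfc F C = cfc (fun w => w * F w) C := by
      rw [cfc_mul (fun w => w) F C continuousOn_id (by rw [hσ]; exact hF), cfc_id' ℂ C]
    rw [h1]
    apply cfc_congr
    intro w hw
    rw [hσ] at hw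
    simp only
    by_cases h0 : w = 0
    · simp [φ, h0, rfun]
    · have h2 := hc w⁻¹ (sphere_re hw h0)
      rw [inv_inv] at h2
      rw [← h2, mellin, ← integral_const_mul]
      apply setIntegral_congr_fun measurableSet_Ioi
      intro u hu
      have hu : 0 < u := hu
      have huc : (u : ℂ) ≠ 0 := by exact_mod_cast hu.ne'
      simp only [φ, rfun, smul_eq_mul]
      rw [Complex.cpow_sub _ _ huc, Complex.cpow_one, Complex.cpow_def_of_ne_zero huc,
        Complex.ofReal_log hu.le]
      push_cast
      field_simp

lemma pair_main {C : L2 →L[ℂ] L2} (hC : IsCesaroOp C) (hN : IsStarNormal C)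
    (hσ : spectrum ℂ C = Metric.sphere (1:ℂ) 1)
    {K : ℝ → ℂ} (hm : Measurable K) (hK : KerInt K)
    {F : ℂ → ℂ} (hF : ContinuousOn F (Metric.sphere (1:ℂ) 1))
    (hc : ∀ z : ℂ, z.re = 1/2 → mellin K z = F z⁻¹) (g f : L2) :
    inner ℂ g (cfc F C f) = ∫ u in Set.Ioi 0, K u * inner ℂ g (dil u f) := by
  obtain ⟨hI, hE⟩ := main_cfc hN hσ hm hK hF hc
  -- the identity on the range of the adjoint
  have h1 : ∀ g', inner ℂ (ContinuousLinearMap.adjoint C g') (cfc F C f)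
      = ∫ u in Set.Ioi 0, K u * inner ℂ (ContinuousLinearMap.adjoint C g') (dil u f) := by
    intro g'
    let L : (L2 →L[ℂ] L2) →L[ℂ] ℂ := (innerSL ℂ g') ∘L (ContinuousLinearMap.apply ℂ L2 f)
    have hL : ∀ T, L T = inner ℂ g' (T f) := fun T => rfl
    rw [ContinuousLinearMap.adjoint_inner_left]
    have h2 : inner ℂ g' (C (cfc F C f)) = L (C * cfc F C) := rfl
    rw [h2, hE, ← L.integral_comp_comm hI]
    apply setIntegral_congr_fun measurableSet_Ioi
    intro u hu
    have hu : 0 < u := hu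
    simp only
    rw [← S_eq_R hN hσ hC hu, ContinuousLinearMap.adjoint_inner_left, map_smul, hL, Sop,
      smul_apply, inner_smul_right_eq_smul, smul_eq_mul, Complex.real_smul]
    have huc : (u : ℂ) ≠ 0 := by exact_mod_cast hu.ne'
    rw [mul_apply_eq_comp]
    push_cast
    field_simp
  -- density
  have hdense : Dense (Set.range (ContinuousLinearMap.adjoint C)) := by
    have hker : C.ker = ⊥ := by
      rw [LinearMap.ker_eq_bot']
      exact fun f hf => C_inj hC f hf
    have h3 : (ContinuousLinearMap.adjoint C).range.topologicalClosure = ⊤ := by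
      rw [Submodule.topologicalClosure_eq_top_iff, ContinuousLinearMap.orthogonal_range,
        ContinuousLinearMap.adjoint_adjoint, hker]
    rw [dense_iff_closure_eq]
    have h4 := congrArg (fun p : Submodule ℂ L2 => (p : Set L2)) h3
    rw [Submodule.topologicalClosure_coe] at h4
    exact h4
  let Φ : L2 → ℂ := fun g => ∫ u in Set.Ioi 0, K u * inner ℂ g (dil u f)
  set M := ∫ u in Set.Ioi 0, ‖K u‖ * u ^ (-(1/2) : ℝ) with hM
  have hΦ : ∀ g g', ‖Φ g - Φ g'‖ ≤ (M * ‖f‖) * ‖g - g'‖ := by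
    intro g g'
    have : Φ g - Φ g' = ∫ u in Set.Ioi 0, K u * inner ℂ (g - g') (dil u f) := by
      simp only [Φ]
      rw [← integral_sub (pair_integrable hm hK g f) (pair_integrable hm hK g' f)]
      simp only [inner_sub_left, mul_sub]
    rw [this]
    have h5 : (M * ‖f‖) * ‖g - g'‖
        = ∫ u in Set.Ioi 0, (‖K u‖ * u ^ (-(1/2) : ℝ)) * (‖f‖ * ‖g - g'‖) := by
      rw [integral_mul_const, ← hM]; ring
    rw [h5]
    refine norm_integral_le_of_norm_le (hK.mul_const _) ?_
    filter_upwards [ae_restrict_mem measurableSet_Ioi] with u hu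
    rw [norm_mul, mul_assoc]
    gcongr
    calc ‖inner ℂ (g - g') (dil u f)‖ ≤ ‖g - g'‖ * ‖dil u f‖ := norm_inner_le_norm _ _
      _ ≤ ‖g - g'‖ * (u ^ (-(1/2) : ℝ) * ‖f‖) := by
          gcongr; exact (dil u).le_of_opNorm_le (dil_norm hu) f
      _ = _ := by ring
  have hΦc : Continuous Φ := by
    have : LipschitzWith (Real.toNNReal (M * ‖f‖)) Φ := by
      refine LipschitzWith.of_dist_le_mul fun g g' => ?_
      rw [dist_eq_norm, dist_eq_norm]
      refine (hΦ g g').trans ?_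
      gcongr
      exact Real.le_coe_toNNReal _
    exact this.continuous
  have := Continuous.ext_on hdense (f := fun g => inner ℂ g (cfc F C f)) (g := Φ)
    (by fun_prop) hΦc (by rintro _ ⟨g', rfl⟩; exact h1 g')
  exact congrFun this g

/-- If a measurable `K` satisfies (a) `K = 0` a.e. on `(-∞,0)`,
(b) `K(u) u^{-1/2} ∈ L¹(0,∞)`, and (c) `(ℳK)(z) = F(1/z)` on the line `Re z = 1/2`,
where `F` is holomorphic in some neighborhood of the circle `𝕋+1`, then `F 0 = 0`
and the Hausdorff operator `ℋ_K` equals `F(C)` (holomorphic functional calculus,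
realized for the normal Cesàro operator `C` as `cfc F C`). -/
theorem stmt1
    (C : L2 →L[ℂ] L2) (hC : IsCesaroOp C) (hN : IsStarNormal C)
    (hσ : spectrum ℂ C = Metric.sphere (1:ℂ) 1)
    (K : ℝ → ℂ) (hKmeas : Measurable K)
    (ha : ∀ᵐ u : ℝ ∂MeasureTheory.volume, u < 0 → K u = 0)
    (hb : MeasureTheory.IntegrableOn (fun u : ℝ => ‖K u‖ * u ^ (-(1/2) : ℝ)) (Set.Ioi 0))
    (F : ℂ → ℂ) (U : Set ℂ) (hU : IsOpen U)
    (hsub : Metric.sphere (1:ℂ) 1 ⊆ U)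
    (hF : DifferentiableOn ℂ F U)
    (hc : ∀ z : ℂ, z.re = 1/2 → mellin K z = F z⁻¹) :
    F 0 = 0 ∧ IsHausdorffOp K (cfc F C) := by
  refine ⟨F_zero K F U hU hsub hF hc, ?_⟩
  intro f
  have hFc : ContinuousOn F (Metric.sphere (1:ℂ) 1) := hF.continuousOn.mono hsub
  have hpair := fun g => pair_main hC hN hσ hKmeas hb hFc hc g f
  -- the integral over the line equals the integral over the half-line
  have hhalf : ∀ x : ℝ, ∫ u : ℝ, K u * f (u * x) = ∫ u in Set.Ioi 0, K u * f (u * x) := by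
    intro x
    symm
    apply setIntegral_eq_integral_of_ae_compl_eq_zero
    have hne : ∀ᵐ u : ℝ, u ≠ 0 := by simp [ae_iff]
    filter_upwards [ha, hne] with u hu hu0 hu1
    have : u < 0 := lt_of_le_of_ne (by simpa using hu1) hu0
    rw [hu this, zero_mul]
  have hfub := fun g => fubini_int hKmeas hb g f
  -- integrability over finite measure sets
  have hind : ∀ s : Set ℝ, ∀ hs : MeasurableSet s, ∀ hfin : volume s ≠ ⊤,
      (fun x => inner ℂ ((indicatorConstLp 2 hs hfin (1:ℂ) : L2) x)
        (∫ u in Set.Ioi 0, K u * f (u * x))) =ᵐ[volume]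
      s.indicator (fun x => ∫ u in Set.Ioi 0, K u * f (u * x)) := by
    intro s hs hfin
    filter_upwards [indicatorConstLp_coeFn (p := 2) (hs := hs) (hμs := hfin) (c := (1:ℂ))] with x hx
    rw [hx]
    by_cases hxs : x ∈ s <;> simp [hxs]
  have hae : cfc F C f =ᵐ[volume] fun x => ∫ u in Set.Ioi 0, K u * f (u * x) := by
    apply ae_eq_of_forall_setIntegral_eq_of_sigmaFinite
    · intro s hs hfin
      exact integrableOn_Lp_of_measure_ne_top _ (by norm_num) hfin.ne
    · intro s hs hfin
      rw [← integrable_indicator_iff hs]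
      have h1 := (hfub (indicatorConstLp 2 hs hfin.ne (1:ℂ))).integral_prod_left
      refine (h1.congr ?_).congr (hind s hs hfin.ne)
      refine Eventually.of_forall fun x => ?_
      simp only [RCLike.inner_apply, Function.uncurry]
      rw [← integral_mul_const]
    · intro s hs hfin
      have h1 := hpair (indicatorConstLp 2 hs hfin.ne (1:ℂ))
      rw [← pair_eq hKmeas hb, integral_congr_ae (hind s hs hfin.ne), integral_indicator hs,
        L2.inner_indicatorConstLp_one] at h1
      exact h1
  filter_upwards [hae] with x hx
  rw [hx, hhalf]
end
end
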